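/- arXiv:1705.01594 — 3 statements merged into one kernel-verified Lean document; each statement's English description precedes it below -/
import Mathlib

section
/- Let R be a commutative Noetherian ring, I an ideal of R, and M an R-module such that Tor_i^R(R/I, M) = 0 for all integers i ≥ 0. Then Hom_R(R/I, M) = 0. -/
open CategoryTheory

noncomputable section

universe u

/-- `Tor_i^R(A, B)` as an object of `ModuleCat R`. -/
def TorMod (R : Type u) [CommRing R] (i : ℕ) (A B : ModuleCat.{u} R) : ModuleCat.{u} R :=
  ((Tor (ModuleCat.{u} R) i).obj A).obj B

/-- `Ext^i_R(A, B)` as an object of `ModuleCat R`. -/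
def ExtMod (R : Type u) [CommRing R] (i : ℕ) (A B : ModuleCat.{u} R) : ModuleCat.{u} R :=
  ((Ext R (ModuleCat.{u} R) i).obj (Opposite.op A)).obj B

/-- `H^i_I(M)`, the `i`-th local cohomology of `M` with support in `I`. -/
def LC (R : Type u) [CommRing R] (I : Ideal R) (i : ℕ) (M : ModuleCat.{u} R) : ModuleCat.{u} R :=
  (localCohomology I i).obj M

/-- `M` is `I`-cofinite: `Supp M ⊆ V(I)` and all `Ext^i_R(R/I, M)` are finitely generated. -/
def IsCofinite (R : Type u) [CommRing R] (I : Ideal R) (M : ModuleCat.{u} R) : Prop :=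
  Module.support R M ⊆ PrimeSpectrum.zeroLocus (I : Set R) ∧
    ∀ i : ℕ, Module.Finite R (ExtMod R i (ModuleCat.of R (R ⧸ I)) M)

/-- `Γ_I(M) = ⋃ₙ (0 :_M Iⁿ)`, the `I`-torsion submodule of `M`. -/
def torsionGamma (R : Type u) [CommRing R] (I : Ideal R) (M : Type u) [AddCommGroup M]
    [Module R M] : Submodule R M :=
  ⨆ n : ℕ, Submodule.torsionBySet R M ((I ^ n : Ideal R) : Set R)

open scoped TensorProduct

section Koszul
variable {R : Type u} [CommRing R]

lemma kos_contract_mem {E : Type u} [AddCommGroup E] [Module R E] (φ : Module.Dual R E) (j : ℕ) :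
    ∀ z ∈ ⋀[R]^(j+1) E, CliffordAlgebra.contractLeft (Q := (0 : QuadraticForm R E)) φ z ∈ ⋀[R]^j E := by
  induction j with
  | zero =>
    intro z hz
    rw [ExteriorAlgebra.exteriorPower, zero_add, pow_one] at hz
    obtain ⟨a, rfl⟩ := hz
    have := CliffordAlgebra.contractLeft_ι (0 : QuadraticForm R E) φ a
    erw [this]
    rw [ExteriorAlgebra.exteriorPower, pow_zero]
    exact Submodule.algebraMap_mem _
  | succ j ih =>
    intro z hz
    rw [ExteriorAlgebra.exteriorPower, pow_succ'] at hz
    induction hz using Submodule.mul_induction_on' with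
    | mem_mul_mem m hm n hn =>
      obtain ⟨a, rfl⟩ := hm
      have := CliffordAlgebra.contractLeft_ι_mul (Q := (0 : QuadraticForm R E)) φ a n
      erw [this]
      refine Submodule.sub_mem _ (Submodule.smul_mem _ _ hn) ?_
      rw [ExteriorAlgebra.exteriorPower, pow_succ']
      exact Submodule.mul_mem_mul ⟨a, rfl⟩ (ih n hn)
    | add x hx y hy h1 h2 => rw [map_add]; exact Submodule.add_mem _ h1 h2

/-- Koszul differential: left multiplication by `v`. -/
noncomputable def kosD {E : Type u} [AddCommGroup E] [Module R E] (v : E) (j : ℕ) :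
    ⋀[R]^j E →ₗ[R] ⋀[R]^(j+1) E :=
  (LinearMap.mulLeft R (ExteriorAlgebra.ι R v)).restrict (by
    intro x hx
    rw [ExteriorAlgebra.exteriorPower, pow_succ']
    exact Submodule.mul_mem_mul ⟨v, rfl⟩ hx)

lemma kosD_coe {E : Type u} [AddCommGroup E] [Module R E] (v : E) (j : ℕ) (x : ⋀[R]^j E) :
    ((kosD v j x : ⋀[R]^(j+1) E) : ExteriorAlgebra R E) = ExteriorAlgebra.ι R v * x := rfl

lemma kosD_kosD {E : Type u} [AddCommGroup E] [Module R E] (v : E) (j : ℕ) (x : ⋀[R]^j E) :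
    kosD v (j+1) (kosD v j x) = 0 := by
  apply Subtype.ext
  rw [kosD_coe, kosD_coe, ← mul_assoc, ExteriorAlgebra.ι_sq_zero, zero_mul]; rfl

lemma kosD_homotopy {E : Type u} [AddCommGroup E] [Module R E] (v : E) (φ : Module.Dual R E) (j : ℕ)
    (z : ⋀[R]^(j+1) E) (hz : kosD v (j+1) z = 0) : φ v • z ∈ LinearMap.range (kosD v j) := by
  have h1 : ExteriorAlgebra.ι R v * (z : ExteriorAlgebra R E) = 0 := by
    rw [← kosD_coe, hz]; rfl
  have := CliffordAlgebra.contractLeft_ι_mul (Q := (0 : QuadraticForm R E)) φ v z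
  erw [h1] at this
  rw [map_zero] at this
  refine ⟨⟨_, kos_contract_mem φ j z z.2⟩, Subtype.ext ?_⟩
  rw [kosD_coe]
  exact (sub_eq_zero.1 this.symm).symm

lemma kosD_homotopy_zero {E : Type u} [AddCommGroup E] [Module R E] (v : E) (φ : Module.Dual R E)
    (z : ⋀[R]^0 E) (hz : kosD v 0 z = 0) : φ v • z = 0 := by
  have h1 : ExteriorAlgebra.ι R v * (z : ExteriorAlgebra R E) = 0 := by
    rw [← kosD_coe, hz]; rfl
  have := CliffordAlgebra.contractLeft_ι_mul (Q := (0 : QuadraticForm R E)) φ v z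
  erw [h1] at this
  have hz : (z : ExteriorAlgebra R E) ∈ (LinearMap.range (ExteriorAlgebra.ι R (M := E))) ^ 0 := z.2
  rw [pow_zero] at hz
  obtain ⟨r, hr⟩ := Submodule.mem_one.1 hz
  have h2 := CliffordAlgebra.contractLeft_algebraMap (0 : QuadraticForm R E) φ r
  erw [hr] at h2
  erw [h2] at this
  rw [map_zero, mul_zero, sub_zero] at this
  exact Subtype.ext this.symm

theorem kos_exists (I : Ideal R) (hI : I.FG) : ∃ (n : ℕ) (K : ℕ → Type u) (_ : ∀ j, AddCommGroup (K j))
    (_ : ∀ j, Module R (K j)) (d : ∀ j, K j →ₗ[R] K (j+1)),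
    (∀ j, Module.Finite R (K j)) ∧ (∀ j, Module.Free R (K j)) ∧ (∀ j, n < j → Subsingleton (K j)) ∧
    (∀ j x, d (j+1) (d j x) = 0) ∧
    (∀ j, ∀ x ∈ I, ∀ z, d (j+1) z = 0 → x • z ∈ LinearMap.range (d j)) ∧
    (∀ x ∈ I, ∀ z, d 0 z = 0 → x • z = 0) ∧
    ∀ (M : Type u) [AddCommGroup M] [Module R M] (m : M), (∀ x ∈ I, x • m = 0) →
      (∀ t : K 0 ⊗[R] M, (d 0).rTensor M t = 0 → t = 0) → m = 0 := by
  obtain ⟨n, x, hx⟩ := Submodule.fg_iff_exists_fin_generating_family.1 hI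
  let E := ULift.{u} (Fin n) → R
  let v : E := fun i => x i.down
  refine ⟨n, fun j => ⋀[R]^j E, inferInstance, inferInstance, kosD v, inferInstance, inferInstance,
    ?_, kosD_kosD v, ?_, ?_, ?_⟩
  · intro j hj
    rcases subsingleton_or_nontrivial R with hR | hR
    · exact Module.subsingleton R _
    apply Module.subsingleton_of_rank_zero (R := R)
    rw [← Module.finrank_eq_rank, exteriorPower.finrank_eq]
    simp [E, Nat.choose_eq_zero_of_lt hj]
  · intro j a ha z hz
    rw [← hx] at ha
    induction ha using Submodule.span_induction with
    | mem a ha => obtain ⟨i, rfl⟩ := ha; exact kosD_homotopy v (LinearMap.proj (ULift.up i)) j z hz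
    | zero => simp
    | add a b _ _ h1 h2 => rw [add_smul]; exact Submodule.add_mem _ h1 h2
    | smul r a _ h => rw [smul_assoc]; exact Submodule.smul_mem _ _ h
  · intro a ha z hz
    rw [← hx] at ha
    induction ha using Submodule.span_induction with
    | mem a ha => obtain ⟨i, rfl⟩ := ha; exact kosD_homotopy_zero v (LinearMap.proj (ULift.up i)) z hz
    | zero => simp
    | add a b _ _ h1 h2 => rw [add_smul, h1, h2, add_zero]
    | smul r a _ h => rw [smul_assoc, h, smul_zero]
  · intro M _ _ m hm ht
    let e := exteriorPower.zeroEquiv R E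
    have h := ht (e.symm 1 ⊗ₜ m) (by
      rw [LinearMap.rTensor_tmul]
      let e1 := exteriorPower.oneEquiv R E
      have h3 : kosD v 0 (e.symm 1) = e1.symm v := by
        apply Subtype.ext
        rw [kosD_coe]
        simp [e, e1, exteriorPower.zeroEquiv_symm_apply, exteriorPower.oneEquiv_symm_apply, ExteriorAlgebra.ιMulti_apply]
      rw [h3, show v = ∑ i, x i.down • (Pi.single i 1 : E) by
        ext i; simp [v, Finset.sum_apply, Pi.single_apply], map_sum, TensorProduct.sum_tmul]
      refine Finset.sum_eq_zero fun i _ => ?_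
      rw [map_smul, TensorProduct.smul_tmul, hm, TensorProduct.tmul_zero]
      rw [← hx]; exact Submodule.subset_span ⟨_, rfl⟩)
    have h' := congrArg (fun t => TensorProduct.lid R M (LinearMap.rTensor M e.toLinearMap t)) h
    simpa using h'
end Koszul

section Hom
open MonoidalCategory Limits
variable {R : Type u} [CommRing R] 

/-- The complex `N ⊗ P`. -/
noncomputable abbrev tcx (P : ChainComplex (ModuleCat.{u} R) ℕ) (N : ModuleCat.{u} R) :
    ChainComplex (ModuleCat.{u} R) ℕ :=
  (((tensoringLeft (ModuleCat.{u} R)).obj N).mapHomologicalComplex (ComplexShape.down ℕ)).obj P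

/-- The induced map `N ⊗ P ⟶ N' ⊗ P`. -/
noncomputable abbrev tcxMap (P : ChainComplex (ModuleCat.{u} R) ℕ) {N N' : ModuleCat.{u} R} (f : N ⟶ N') :
    tcx P N ⟶ tcx P N' :=
  (NatTrans.mapHomologicalComplex ((tensoringLeft (ModuleCat.{u} R)).map f) (ComplexShape.down ℕ)).app P

/-- Vanishing of the `i`-th homology of `N ⊗ P`. -/
def tvan (P : ChainComplex (ModuleCat.{u} R) ℕ) (i : ℕ) (N : Type u) [AddCommGroup N] [Module R N] : Prop :=
  IsZero ((tcx P (ModuleCat.of R N)).homology i)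

variable (P : ChainComplex (ModuleCat.{u} R) ℕ)

section ses
variable {A B C : Type u} [AddCommGroup A] [AddCommGroup B] [AddCommGroup C]
  [Module R A] [Module R B] [Module R C] {f : A →ₗ[R] B} {g : B →ₗ[R] C}

lemma tcx_ses (hP : ∀ i, Module.Flat R (P.X i))
    (hf : Function.Injective f) (hg : Function.Surjective g) (hfg : Function.Exact f g) :
    ∃ h, (ShortComplex.mk (tcxMap P (ModuleCat.ofHom f)) (tcxMap P (ModuleCat.ofHom g)) h).ShortExact := by
  have h0 : ∀ i, Function.Exact (f.rTensor (P.X i)) (g.rTensor (P.X i)) := fun i => rTensor_exact _ hfg hg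
  have h1 : ∀ i, Function.Injective (f.rTensor (P.X i)) := fun i =>
    Module.Flat.rTensor_preserves_injective_linearMap _ hf
  have h2 : ∀ i, Function.Surjective (g.rTensor (P.X i)) := fun i => LinearMap.rTensor_surjective _ hg
  refine ⟨?_, ?_⟩
  · ext i x
    exact (h0 i).apply_apply_eq_zero x
  · apply HomologicalComplex.shortExact_of_degreewise_shortExact
    intro i
    exact ModuleCat.shortComplex_shortExact _ (h0 i) (h1 i) (h2 i)

lemma tvan_mid (hP : ∀ i, Module.Flat R (P.X i)) (i : ℕ)
    (hf : Function.Injective f) (hg : Function.Surjective g) (hfg : Function.Exact f g)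
    (hA : tvan P i A) (hC : tvan P i C) : tvan P i B := by
  obtain ⟨h, hS⟩ := tcx_ses P hP hf hg hfg
  exact (hS.homology_exact₂ i).isZero_of_both_zeros (hA.eq_of_src _ _) (hC.eq_of_tgt _ _)

lemma tvan_right (hP : ∀ i, Module.Flat R (P.X i)) (i : ℕ)
    (hf : Function.Injective f) (hg : Function.Surjective g) (hfg : Function.Exact f g)
    (hA : tvan P i A) (hB : tvan P (i+1) B) : tvan P (i+1) C := by
  obtain ⟨h, hS⟩ := tcx_ses P hP hf hg hfg
  exact (hS.homology_exact₃ (i+1) i rfl).isZero_of_both_zeros (hB.eq_of_src _ _) (hA.eq_of_tgt _ _)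

lemma tvan_left (hP : ∀ i, Module.Flat R (P.X i)) (i : ℕ)
    (hf : Function.Injective f) (hg : Function.Surjective g) (hfg : Function.Exact f g)
    (hC : tvan P (i+1) C) (hB : tvan P i B) : tvan P i A := by
  obtain ⟨h, hS⟩ := tcx_ses P hP hf hg hfg
  exact (hS.homology_exact₁ (i+1) i rfl).isZero_of_both_zeros (hC.eq_of_src _ _) (hB.eq_of_tgt _ _)

lemma tvan_zero_right (hg : Function.Surjective g) (hB : tvan P 0 B) : tvan P 0 C := by
  have : Epi ((tcxMap P (ModuleCat.ofHom g)).f 0) :=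
    (ModuleCat.epi_iff_surjective _).2 (LinearMap.rTensor_surjective (P.X 0) hg)
  have := HomologicalComplex.epi_homologyMap_of_epi_of_not_rel (tcxMap P (ModuleCat.ofHom g)) 0 (by simp)
  exact IsZero.of_epi (HomologicalComplex.homologyMap (tcxMap P (ModuleCat.ofHom g)) 0) hB

lemma tvan_subsingleton [Subsingleton A] (i : ℕ) : tvan P i A := by
  rw [tvan, ← HomologicalComplex.exactAt_iff_isZero_homology]
  apply ShortComplex.exact_of_isZero_X₂
  have : Subsingleton (A ⊗[R] P.X i) := inferInstance
  exact @ModuleCat.isZero_of_subsingleton R _ (ModuleCat.of R (A ⊗[R] P.X i)) this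

lemma tvan_flat [Module.Flat R A] (hP : ∀ i, P.ExactAt (i+1)) (i : ℕ) : tvan P (i+1) A := by
  have h := hP i
  rw [HomologicalComplex.exactAt_iff' _ (i+2) (i+1) i (by simp) (by simp)] at h
  have h' := Module.Flat.lTensor_exact A ((ShortComplex.ShortExact.moduleCat_exact_iff_function_exact _).1 h)
  rw [tvan, ← HomologicalComplex.exactAt_iff_isZero_homology,
    HomologicalComplex.exactAt_iff' _ (i+2) (i+1) i (by simp) (by simp)]
  exact (ShortComplex.ShortExact.moduleCat_exact_iff_function_exact _).2 h'

lemma tvan_exact (i : ℕ) (h : tvan P (i+1) A) :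
    Function.Exact ((P.d (i+2) (i+1)).hom.lTensor A) ((P.d (i+1) i).hom.lTensor A) := by
  rw [tvan, ← HomologicalComplex.exactAt_iff_isZero_homology,
    HomologicalComplex.exactAt_iff' _ (i+2) (i+1) i (by simp) (by simp)] at h
  exact (ShortComplex.ShortExact.moduleCat_exact_iff_function_exact _).1 h

lemma tvan_surj (h : tvan P 0 A) : Function.Surjective ((P.d 1 0).hom.lTensor A) := by
  rw [tvan, ← HomologicalComplex.exactAt_iff_isZero_homology,
    HomologicalComplex.exactAt_iff' _ 1 0 0 (by simp) (by simp)] at h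
  have := (ShortComplex.ShortExact.moduleCat_exact_iff_function_exact _).1 h
  intro y
  obtain ⟨x, hx⟩ := (this y).1 (by
    have h0 : (tcx P (ModuleCat.of R A)).d 0 0 = 0 := HomologicalComplex.shape _ _ _ (by simp)
    change ((tcx P (ModuleCat.of R A)).d 0 0) y = 0
    rw [h0]; rfl)
  exact ⟨x, hx⟩

variable {M : Type u} [AddCommGroup M] [Module R M] (π : P.X 0 →ₗ[R] M)

lemma tvan_tensor (hπ : Function.Surjective π) (hdπ : Function.Exact (P.d 1 0).hom π) (h : tvan P 0 A) :
    Subsingleton (A ⊗[R] M) := by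
  refine ⟨fun a b => ?_⟩
  suffices H : ∀ a : A ⊗[R] M, a = 0 by rw [H a, H b]
  intro a
  obtain ⟨y, rfl⟩ := LinearMap.lTensor_surjective A hπ a
  obtain ⟨z, rfl⟩ := tvan_surj P h y
  exact (lTensor_exact A hdπ hπ).apply_apply_eq_zero z

lemma tvan_inj (hP : ∀ i, Module.Flat R (P.X i))
    (hf : Function.Injective f) (hg : Function.Surjective g) (hfg : Function.Exact f g)
    (hπ : Function.Surjective π) (hdπ : Function.Exact (P.d 1 0).hom π)
    (hC : tvan P 1 C) : Function.Injective (f.rTensor M) := by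
  have comm : ∀ {A B P Q : Type u} [AddCommGroup A] [AddCommGroup B] [AddCommGroup P] [AddCommGroup Q]
     [Module R A] [Module R B] [Module R P] [Module R Q] (f : A →ₗ[R] B) (p : P →ₗ[R] Q) (x : A ⊗[R] P),
     f.rTensor Q (p.lTensor A x) = p.lTensor B (f.rTensor P x) := by
    intro A B P Q _ _ _ _ _ _ _ _ f p x
    rw [← LinearMap.comp_apply, ← LinearMap.comp_apply, LinearMap.rTensor_comp_lTensor, LinearMap.lTensor_comp_rTensor]
  rw [injective_iff_map_eq_zero]
  intro x hx
  obtain ⟨y, rfl⟩ := LinearMap.lTensor_surjective A hπ x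
  rw [comm] at hx
  obtain ⟨z, hz⟩ := (lTensor_exact B hdπ hπ _).1 hx
  have h1 : (P.d 1 0).hom.lTensor C (g.rTensor _ z) = 0 := by
    rw [← comm, hz]
    exact (rTensor_exact _ hfg hg).apply_apply_eq_zero y
  obtain ⟨w, hw⟩ := (tvan_exact P 0 hC _).1 h1
  obtain ⟨w', rfl⟩ := LinearMap.rTensor_surjective (P.X 2) hg w
  have h2 : g.rTensor (P.X 1) (z - (P.d 2 1).hom.lTensor B w') = 0 := by
    rw [map_sub, comm, sub_eq_zero]; exact hw.symm
  obtain ⟨a, ha⟩ := (rTensor_exact _ hfg hg _).1 h2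
  have hdd : (P.d 1 0).hom.lTensor B ((P.d 2 1).hom.lTensor B w') = 0 := by
    rw [← LinearMap.comp_apply, ← LinearMap.lTensor_comp, ← ModuleCat.hom_comp, P.d_comp_d]
    simp
  have h3 : (P.d 1 0).hom.lTensor A a = y := by
    apply Module.Flat.rTensor_preserves_injective_linearMap (M := P.X 0) f hf
    rw [comm, ha, map_sub, hdd, sub_zero, hz]
  rw [← h3]
  exact (lTensor_exact A hdπ hπ).apply_apply_eq_zero a
end ses

lemma tvan_killed [IsNoetherianRing R] (hP : ∀ i, Module.Flat R (P.X i)) (I : Ideal R)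
    (hI : ∀ i, tvan P i (R ⧸ I)) (i : ℕ) : ∀ (N : Type u) [AddCommGroup N] [Module R N]
    [Module.Finite R N], (∀ x ∈ I, ∀ n : N, x • n = 0) → tvan P i N := by
  have quot : ∀ (N : Type u) [AddCommGroup N] [Module R N] (p : Ideal R), (N ≃ₗ[R] R ⧸ p) →
      (∀ x ∈ I, ∀ n : N, x • n = 0) → ∃ g : (R ⧸ I) →ₗ[R] N, Function.Surjective g := by
    intro N _ _ p e hN
    have hIp : I ≤ p := by
      intro x hx
      have := congrArg e (hN x hx (e.symm 1))
      rw [map_smul, e.apply_symm_apply, map_zero] at this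
      rw [← Ideal.Quotient.eq_zero_iff_mem, ← this, Algebra.smul_def, mul_one]; rfl
    exact ⟨e.symm.toLinearMap ∘ₗ Submodule.factor hIp, e.symm.surjective.comp (Submodule.factor_surjective hIp)⟩
  induction i with
  | zero =>
    intro N _ _ hfin
    induction hfin using IsNoetherianRing.induction_on_isQuotientEquivQuotientPrime R with
    | subsingleton N => exact fun _ => tvan_subsingleton P 0
    | quotient N p e =>
      intro hN
      obtain ⟨g, hg⟩ := quot N p.1 e hN
      exact tvan_zero_right P hg (hI 0)
    | exact N₁ N₂ N₃ f g hf hg hfg h₁ h₃ =>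
      intro hN
      refine tvan_mid P hP 0 hf hg hfg (h₁ fun x hx n => hf ?_) (h₃ fun x hx n => ?_)
      · rw [map_smul, hN x hx, map_zero]
      · obtain ⟨n, rfl⟩ := hg n
        rw [← map_smul, hN x hx, map_zero]
  | succ i ih =>
    intro N _ _ hfin
    induction hfin using IsNoetherianRing.induction_on_isQuotientEquivQuotientPrime R with
    | subsingleton N => exact fun _ => tvan_subsingleton P _
    | quotient N p e =>
      intro hN
      obtain ⟨g, hg⟩ := quot N p.1 e hN
      refine tvan_right P hP i (LinearMap.ker g).injective_subtype hg (LinearMap.exact_subtype_ker_map g)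
        (ih _ fun x hx n => Subtype.ext ?_) (hI _)
      obtain ⟨n, hn⟩ := n
      obtain ⟨n, rfl⟩ := Ideal.Quotient.mk_surjective n
      change x • Ideal.Quotient.mk I n = 0
      rw [Algebra.smul_def]
      change Ideal.Quotient.mk I x * _ = 0
      rw [Ideal.Quotient.eq_zero_iff_mem.2 hx, zero_mul]
    | exact N₁ N₂ N₃ f g hf hg hfg h₁ h₃ =>
      intro hN
      refine tvan_mid P hP _ hf hg hfg (h₁ fun x hx n => hf ?_) (h₃ fun x hx n => ?_)
      · rw [map_smul, hN x hx, map_zero]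
      · obtain ⟨n, rfl⟩ := hg n
        rw [← map_smul, hN x hx, map_zero]

lemma kos_core [IsNoetherianRing R] (hP : ∀ i, Module.Flat R (P.X i)) (hPe : ∀ i, P.ExactAt (i+1))
    (I : Ideal R) (hI : ∀ i, tvan P i (R ⧸ I))
    {M : Type u} [AddCommGroup M] [Module R M] (π : P.X 0 →ₗ[R] M)
    (hπ : Function.Surjective π) (hdπ : Function.Exact (P.d 1 0).hom π)
    (n : ℕ) (K : ℕ → Type u) [∀ j, AddCommGroup (K j)]
    [∀ j, Module R (K j)] (d : ∀ j, K j →ₗ[R] K (j+1))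
    [∀ j, Module.Finite R (K j)] [∀ j, Module.Free R (K j)] (hK : ∀ j, n < j → Subsingleton (K j))
    (hd : ∀ j x, d (j+1) (d j x) = 0)
    (hH : ∀ j, ∀ x ∈ I, ∀ z, d (j+1) z = 0 → x • z ∈ LinearMap.range (d j))
    (hH0 : ∀ x ∈ I, ∀ z, d 0 z = 0 → x • z = 0) :
    ∀ t : K 0 ⊗[R] M, (d 0).rTensor M t = 0 → t = 0 := by
  have hle : ∀ j, LinearMap.range (d j) ≤ LinearMap.ker (d (j+1)) := by
    rintro j _ ⟨x, rfl⟩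
    exact hd j x
  have hHv : ∀ j i, tvan P i (LinearMap.ker (d (j+1)) ⧸ LinearMap.range (Submodule.inclusion (hle j))) := by
    intro j i
    apply tvan_killed P hP I hI
    intro x hx z
    obtain ⟨⟨z, hz⟩, rfl⟩ := Submodule.mkQ_surjective _ z
    rw [← map_smul]
    apply (Submodule.Quotient.mk_eq_zero _).2
    exact ⟨⟨_, hH j x hx z hz⟩, rfl⟩
  have hB : ∀ k j, n ≤ j + k → ∀ i, tvan P (i+1) (LinearMap.range (d j)) := by
    intro k
    induction k with
    | zero =>
      intro j hj i
      have := hK (j+1) (by omega)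
      exact tvan_subsingleton P _
    | succ k ih =>
      intro j hj i
      have h1 := ih (j+1) (by omega)
      have hZ : tvan P (i+1) (LinearMap.ker (d (j+1))) :=
        tvan_left P hP (i+1) (LinearMap.ker (d (j+1))).injective_subtype
          (LinearMap.surjective_rangeRestrict (d (j+1)))
          (by rw [LinearMap.exact_iff, LinearMap.ker_rangeRestrict, Submodule.range_subtype])
          (h1 (i+1)) (tvan_flat P hPe i)
      exact tvan_left P hP (i+1) (Submodule.inclusion_injective (hle j)) (Submodule.mkQ_surjective _)
        (LinearMap.exact_map_mkQ_range _) (hHv j _) hZ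
  have i1 : Function.Injective ((Submodule.inclusion (hle 0)).rTensor M) :=
    tvan_inj P π hP (Submodule.inclusion_injective (hle 0)) (Submodule.mkQ_surjective _)
        (LinearMap.exact_map_mkQ_range _) hπ hdπ (hHv 0 1)
  have i2 : Function.Injective ((LinearMap.ker (d 1)).subtype.rTensor M) :=
    tvan_inj P π hP (LinearMap.ker (d 1)).injective_subtype
          (LinearMap.surjective_rangeRestrict (d 1))
          (by rw [LinearMap.exact_iff, LinearMap.ker_rangeRestrict, Submodule.range_subtype])
          hπ hdπ (hB n 1 (by omega) 0)
  have hZ0 : Subsingleton (LinearMap.ker (d 0) ⊗[R] M) := by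
    apply tvan_tensor P π hπ hdπ
    apply tvan_killed P hP I hI
    rintro x hx ⟨z, hz⟩
    exact Subtype.ext (hH0 x hx z hz)
  intro t ht
  have e : d 0 = (LinearMap.ker (d 1)).subtype ∘ₗ Submodule.inclusion (hle 0) ∘ₗ (d 0).rangeRestrict := by
    ext x; rfl
  rw [e, LinearMap.rTensor_comp, LinearMap.rTensor_comp, LinearMap.comp_apply, LinearMap.comp_apply] at ht
  have ht' := (injective_iff_map_eq_zero _).1 i1 _ ((injective_iff_map_eq_zero _).1 i2 _ ht)
  have hex : Function.Exact (LinearMap.ker (d 0)).subtype (d 0).rangeRestrict := by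
    rw [LinearMap.exact_iff, LinearMap.ker_rangeRestrict, Submodule.range_subtype]
  obtain ⟨s, rfl⟩ := (rTensor_exact M hex (LinearMap.surjective_rangeRestrict (d 0)) t).1 ht'
  rw [Subsingleton.elim s 0, map_zero]

end Hom

theorem stmt0 (R : Type u) [CommRing R] [IsNoetherianRing R] (I : Ideal R)
    (M : Type u) [AddCommGroup M] [Module R M]
    (h : ∀ i : ℕ, Subsingleton (TorMod R i (ModuleCat.of R (R ⧸ I)) (ModuleCat.of R M))) :
    Subsingleton ((R ⧸ I) →ₗ[R] M) := by
  obtain ⟨P⟩ := HasProjectiveResolution.out (Z := ModuleCat.of R M)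
  have hP : ∀ i, Module.Flat R (P.complex.X i) := fun i => by
    have := P.projective i
    have : Module.Projective R (P.complex.X i) := (IsProjective.iff_projective _).2 this
    infer_instance
  have hI : ∀ i, tvan P.complex i (R ⧸ I) := fun i => by
    have h0 : Limits.IsZero (TorMod R i (ModuleCat.of R (R ⧸ I)) (ModuleCat.of R M)) :=
      @ModuleCat.isZero_of_subsingleton R _ _ (h i)
    exact h0.of_iso (P.isoLeftDerivedObj
      ((MonoidalCategory.tensoringLeft (ModuleCat.{u} R)).obj (ModuleCat.of R (R ⧸ I))) i).symm
  have hdπ : Function.Exact (P.complex.d 1 0).hom (P.π.f 0).hom :=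
    (ShortComplex.ShortExact.moduleCat_exact_iff_function_exact _).1 P.exact₀
  have hπ : Function.Surjective (P.π.f 0).hom := (ModuleCat.epi_iff_surjective _).1 inferInstance
  obtain ⟨n, K, _, _, d, _, _, hK, hd, hH, hH0, hM⟩ := kos_exists I (IsNoetherian.noetherian I)
  have key := kos_core P.complex hP P.complex_exactAt_succ I hI (M := M) (P.π.f 0).hom hπ hdπ n K d hK hd hH hH0
  refine ⟨fun f g => ?_⟩
  have H : ∀ f : (R ⧸ I) →ₗ[R] M, f = 0 := by
    intro f
    have h1 : f (Ideal.Quotient.mk I 1) = 0 := hM M _ (fun x hx => by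
      rw [← map_smul, Algebra.smul_def]
      change f (Ideal.Quotient.mk I x * _) = 0
      rw [Ideal.Quotient.eq_zero_iff_mem.2 hx, zero_mul, map_zero]) key
    ext
    exact h1
  rw [H f, H g]
end
end

section
/- Let R be a commutative Noetherian ring, I an ideal of R, and M an R-module. Then Tor_n^R(R/I, M) = 0 for all integers n ≥ 0 if and only if Ext_R^n(R/I, M) = 0 for all integers n ≥ 0. -/
open CategoryTheory

noncomputable section

universe u

structure Cx (R : Type u) [CommRing R] where
  X : ℤ → ModuleCat.{u} R
  d : ∀ n, X n →ₗ[R] X (n + 1)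
  dd : ∀ n (y : X n), d (n + 1) (d n y) = 0

namespace Cx

variable {R : Type u} [CommRing R]

def cone (x : R) (Y : Cx R) : Cx R where
  X n := ModuleCat.of R (Y.X (n + 1) × Y.X n)
  d n := LinearMap.prod (-(Y.d (n + 1) ∘ₗ LinearMap.fst R _ _))
    (x • LinearMap.fst R _ _ + Y.d n ∘ₗ LinearMap.snd R _ _)
  dd n y := by
    refine Prod.ext ?_ ?_
    · change -(Y.d _ (-(Y.d _ y.1))) = 0
      simp [Y.dd]
    · change x • (-(Y.d _ y.1)) + Y.d _ (x • y.1 + Y.d _ y.2) = 0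
      simp [Y.dd]

theorem cone_d (x : R) (Y : Cx R) (n : ℤ) (a : Y.X (n + 1)) (b : Y.X n) :
    (cone x Y).d n (a, b) = (-(Y.d _ a), x • a + Y.d _ b) := rfl

def Ex (Y : Cx R) : Prop := ∀ n (z : Y.X (n + 1)), Y.d _ z = 0 → ∃ y, Y.d n y = z

def TorV (I : Ideal R) (Y : Cx R) : Prop :=
  ∀ n (z : Y.X (n + 1)), Y.d _ z ∈ (I • ⊤ : Submodule R (Y.X (n + 1 + 1))) →
    ∃ y, z - Y.d n y ∈ (I • ⊤ : Submodule R (Y.X (n + 1)))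

def ExtV (I : Ideal R) (Y : Cx R) : Prop :=
  ∀ n (z : Y.X (n + 1)), (∀ r ∈ I, r • z = 0) → Y.d _ z = 0 →
    ∃ y, (∀ r ∈ I, r • y = 0) ∧ Y.d n y = z

def Nil (x : R) (Y : Cx R) : Prop :=
  ∃ k : ℕ, ∀ n (z : Y.X (n + 1)), Y.d _ z = 0 → ∃ y, Y.d n y = x ^ k • z

theorem Nil.cone_self (x : R) (Y : Cx R) : Nil x (cone x Y) := by
  refine ⟨1, fun n z hz => ?_⟩
  obtain ⟨a, b⟩ := z
  rw [cone_d] at hz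
  obtain ⟨h1, h2⟩ := Prod.ext_iff.1 hz
  refine ⟨(b, 0), ?_⟩
  rw [cone_d]
  refine Prod.ext ?_ ?_
  · change -(Y.d _ b) = x ^ 1 • a
    change x • a + Y.d _ b = 0 at h2
    rw [pow_one, neg_eq_iff_add_eq_zero, add_comm (Y.d _ b)]; exact h2
  · change x • b + Y.d _ 0 = x ^ 1 • b
    simp

theorem Nil.cone {x : R} {Y : Cx R} (w : R) (h : Nil x Y) : Nil x (cone w Y) := by
  obtain ⟨k, hk⟩ := h
  refine ⟨k + k, fun n z hz => ?_⟩
  obtain ⟨a, b⟩ := z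
  rw [cone_d] at hz
  obtain ⟨h1, h2⟩ := Prod.ext_iff.1 hz
  change -(Y.d _ a) = 0 at h1
  change w • a + Y.d _ b = 0 at h2
  obtain ⟨a', ha'⟩ := hk _ a (by simpa using h1)
  obtain ⟨b', hb'⟩ := hk _ (x ^ k • b + w • a') (by
    rw [map_add, map_smul, map_smul, ha', ← smul_comm (x ^ k) w, ← smul_add, add_comm (Y.d _ b), h2,
      smul_zero])
  refine ⟨(-(x ^ k • a'), b'), ?_⟩
  rw [cone_d]
  refine Prod.ext ?_ ?_
  · change -(Y.d _ (-(x ^ k • a'))) = x ^ (k + k) • a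
    rw [map_neg, map_smul, ha', neg_neg, smul_smul, pow_add]
  · change w • (-(x ^ k • a')) + Y.d _ b' = x ^ (k + k) • b
    rw [hb', smul_add, smul_smul, ← pow_add, smul_neg, smul_comm w]
    abel

theorem Ex.cone {Y : Cx R} (w : R) (h : Ex Y) : Ex (cone w Y) := by
  intro n z hz
  obtain ⟨a, b⟩ := z
  rw [cone_d] at hz
  obtain ⟨h1, h2⟩ := Prod.ext_iff.1 hz
  change -(Y.d _ a) = 0 at h1
  change w • a + Y.d _ b = 0 at h2
  obtain ⟨a', ha'⟩ := h _ a (by simpa using h1)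
  obtain ⟨b', hb'⟩ := h _ (b + w • a') (by
    rw [map_add, map_smul, ha', add_comm (Y.d _ b), h2])
  refine ⟨(-a', b'), ?_⟩
  rw [cone_d]
  refine Prod.ext ?_ ?_
  · change -(Y.d _ (-a')) = a
    rw [map_neg, ha', neg_neg]
  · change w • (-a') + Y.d _ b' = b
    rw [hb', smul_neg]
    abel

theorem mem_smul_top_prod {I : Ideal R} {A B : Type u} [AddCommGroup A] [AddCommGroup B]
    [Module R A] [Module R B] (z : A × B) :
    z ∈ (I • ⊤ : Submodule R (A × B)) ↔
      z.1 ∈ (I • ⊤ : Submodule R A) ∧ z.2 ∈ (I • ⊤ : Submodule R B) := by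
  constructor
  · intro h
    constructor
    · have := Submodule.mem_map_of_mem (f := LinearMap.fst R A B) h
      rw [Submodule.map_smul''] at this
      exact Submodule.smul_mono le_rfl le_top this
    · have := Submodule.mem_map_of_mem (f := LinearMap.snd R A B) h
      rw [Submodule.map_smul''] at this
      exact Submodule.smul_mono le_rfl le_top this
  · rintro ⟨h1, h2⟩
    have e : z = LinearMap.inl R A B z.1 + LinearMap.inr R A B z.2 := by simp
    rw [e]
    refine add_mem ?_ ?_
    · have := Submodule.mem_map_of_mem (f := LinearMap.inl R A B) h1
      rw [Submodule.map_smul''] at this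
      exact Submodule.smul_mono le_rfl le_top this
    · have := Submodule.mem_map_of_mem (f := LinearMap.inr R A B) h2
      rw [Submodule.map_smul''] at this
      exact Submodule.smul_mono le_rfl le_top this

theorem torV_cone_iff {I : Ideal R} {x : R} (hx : x ∈ I) (Y : Cx R) :
    TorV I (cone x Y) ↔ TorV I Y := by
  constructor
  · intro h n z hz
    obtain ⟨y, hy⟩ := h n ((0, z) : Y.X (n + 1 + 1) × Y.X (n + 1)) (by
      rw [cone_d]
      refine (mem_smul_top_prod _).2 ⟨?_, ?_⟩
      · simp
      · simpa using hz)
    obtain ⟨a, b⟩ := y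
    rw [cone_d] at hy
    have h2 := ((mem_smul_top_prod _).1 hy).2
    change z - (x • a + Y.d _ b) ∈ _ at h2
    refine ⟨b, ?_⟩
    have : z - Y.d _ b = (z - (x • a + Y.d _ b)) + x • a := by abel
    rw [this]
    exact add_mem h2 (Submodule.smul_mem_smul hx trivial)
  · intro h n z hz
    obtain ⟨a, b⟩ := z
    rw [cone_d] at hz
    obtain ⟨h1, h2⟩ := (mem_smul_top_prod _).1 hz
    change -(Y.d _ a) ∈ _ at h1
    change x • a + Y.d _ b ∈ _ at h2
    obtain ⟨a', ha'⟩ := h _ a (by simpa using h1)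
    obtain ⟨b', hb'⟩ := h _ b (by
      have : Y.d _ b = (x • a + Y.d _ b) - x • a := by abel
      rw [this]
      exact sub_mem h2 (Submodule.smul_mem_smul hx trivial))
    refine ⟨(-a', b'), ?_⟩
    rw [cone_d]
    refine (mem_smul_top_prod _).2 ⟨?_, ?_⟩
    · change a - -(Y.d _ (-a')) ∈ _
      simpa using ha'
    · change b - (x • (-a') + Y.d _ b') ∈ _
      have : b - (x • (-a') + Y.d _ b') = (b - Y.d _ b') + x • a' := by
        rw [smul_neg]; abel
      rw [this]
      exact add_mem hb' (Submodule.smul_mem_smul hx trivial)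

theorem extV_cone_iff {I : Ideal R} {x : R} (hx : x ∈ I) (Y : Cx R) :
    ExtV I (cone x Y) ↔ ExtV I Y := by
  constructor
  · intro h n z hz hd
    obtain ⟨y, hI, hy⟩ := h n ((0, z) : Y.X (n + 1 + 1) × Y.X (n + 1))
      (fun r hr => Prod.ext (smul_zero r) (hz r hr)) (by
      rw [cone_d]
      refine Prod.ext ?_ ?_
      · change -(Y.d _ 0) = 0
        simp
      · change x • 0 + Y.d _ z = 0
        simpa using hd)
    obtain ⟨a, b⟩ := y
    rw [cone_d] at hy
    have h2 := (Prod.ext_iff.1 hy).2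
    change x • a + Y.d _ b = z at h2
    refine ⟨b, fun r hr => (Prod.ext_iff.1 (hI r hr)).2, ?_⟩
    have : x • a = 0 := (Prod.ext_iff.1 (hI x hx)).1
    rw [← h2, this, zero_add]
  · intro h n z hI hz
    obtain ⟨a, b⟩ := z
    rw [cone_d] at hz
    obtain ⟨h1, h2⟩ := Prod.ext_iff.1 hz
    change -(Y.d _ a) = 0 at h1
    change x • a + Y.d _ b = 0 at h2
    have hIa : ∀ r ∈ I, r • a = 0 := fun r hr => (Prod.ext_iff.1 (hI r hr)).1
    have hIb : ∀ r ∈ I, r • b = 0 := fun r hr => (Prod.ext_iff.1 (hI r hr)).2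
    obtain ⟨a', hIa', ha'⟩ := h _ a hIa (by simpa using h1)
    obtain ⟨b', hIb', hb'⟩ := h _ b hIb (by
      rw [hIa x hx, zero_add] at h2
      exact h2)
    refine ⟨(-a', b'), fun r hr => Prod.ext ?_ (hIb' r hr), ?_⟩
    · change r • (-a') = 0
      rw [smul_neg, hIa' r hr, neg_zero]
    rw [cone_d]
    refine Prod.ext ?_ ?_
    · change -(Y.d _ (-a')) = a
      rw [map_neg, ha', neg_neg]
    · change x • (-a') + Y.d _ b' = b
      rw [hb', smul_neg, hIa' x hx, neg_zero, zero_add]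

/-- short exact sequences -/
def SES (A B C : Cx R) : Prop :=
  ∃ (i : ∀ n, A.X n →ₗ[R] B.X n) (p : ∀ n, B.X n →ₗ[R] C.X n),
    (∀ n a, i _ (A.d n a) = B.d n (i n a)) ∧ (∀ n b, p _ (B.d n b) = C.d n (p n b)) ∧
    (∀ n a, i n a = 0 → a = 0) ∧ (∀ n c, ∃ b, p n b = c) ∧
    (∀ n a, p n (i n a) = 0) ∧ (∀ n b, p n b = 0 → ∃ a, i n a = b)

theorem SES.cone {A B C : Cx R} (x : R) (h : SES A B C) :
    SES (cone x A) (cone x B) (cone x C) := by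
  obtain ⟨i, p, hi, hp, hii, hps, hpi, hex⟩ := h
  refine ⟨fun n => (i (n + 1)).prodMap (i n), fun n => (p (n + 1)).prodMap (p n),
    ?_, ?_, ?_, ?_, ?_, ?_⟩
  · rintro n ⟨a, b⟩
    refine Prod.ext ?_ ?_
    · change i _ (-(A.d _ a)) = -(B.d _ (i _ a))
      simp [hi]
    · change i _ (x • a + A.d _ b) = x • i _ a + B.d _ (i _ b)
      simp [hi]
  · rintro n ⟨a, b⟩
    refine Prod.ext ?_ ?_
    · change p _ (-(B.d _ a)) = -(C.d _ (p _ a))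
      simp [hp]
    · change p _ (x • a + B.d _ b) = x • p _ a + C.d _ (p _ b)
      simp [hp]
  · rintro n ⟨a, b⟩ h
    exact Prod.ext (hii _ _ (Prod.ext_iff.1 h).1) (hii _ _ (Prod.ext_iff.1 h).2)
  · rintro n ⟨a, b⟩
    obtain ⟨a', ha⟩ := hps _ a
    obtain ⟨b', hb⟩ := hps _ b
    exact ⟨(a', b'), Prod.ext ha hb⟩
  · rintro n ⟨a, b⟩
    exact Prod.ext (hpi _ a) (hpi _ b)
  · rintro n ⟨a, b⟩ h
    obtain ⟨a', ha⟩ := hex _ a (Prod.ext_iff.1 h).1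
    obtain ⟨b', hb⟩ := hex _ b (Prod.ext_iff.1 h).2
    exact ⟨(a', b'), Prod.ext ha hb⟩

theorem SES.ex_iff {A B C : Cx R} (h : SES A B C) (hB : Ex B) : Ex A ↔ Ex C := by
  obtain ⟨i, p, hi, hp, hii, hps, hpi, hex⟩ := h
  constructor
  · intro hA n c hc
    obtain ⟨b, rfl⟩ := hps _ c
    rw [← hp] at hc
    obtain ⟨a, ha⟩ := hex _ _ hc
    obtain ⟨a', rfl⟩ := hA _ a (hii _ _ (by rw [hi, ha, B.dd]))
    obtain ⟨b', hb'⟩ := hB _ (b - i _ a') (by rw [map_sub, ← hi, ha, sub_self])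
    refine ⟨p _ b', ?_⟩
    rw [← hp, hb', map_sub, hpi, sub_zero]
  · intro hC n a ha
    obtain ⟨b, hb⟩ := hB _ (i _ a) (by rw [← hi, ha, map_zero])
    obtain ⟨m, rfl⟩ : ∃ m, n = m + 1 := ⟨n - 1, by ring⟩
    obtain ⟨c, hc⟩ := hC _ (p _ b) (by rw [← hp, hb, hpi])
    obtain ⟨b', rfl⟩ := hps _ c
    obtain ⟨a', ha'⟩ := hex _ (b - B.d _ b') (by rw [map_sub, hp, hc, sub_self])
    refine ⟨a', ?_⟩
    rw [← sub_eq_zero]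
    apply hii
    rw [map_sub, hi, ha', map_sub, B.dd, hb]
    simp

def Proj (Y : Cx R) : Prop := ∀ n, Module.Projective R (Y.X n)

def Inj (Y : Cx R) : Prop := ∀ n, Module.Injective R (Y.X n)

def BddA (Y : Cx R) : Prop := ∃ b : ℤ, ∀ n, b ≤ n → Subsingleton (Y.X n)

def BddB (Y : Cx R) : Prop := ∃ b : ℤ, ∀ n, n ≤ b → Subsingleton (Y.X n)

theorem Proj.cone {Y : Cx R} (x : R) (h : Proj Y) : Proj (cone x Y) := by
  intro n
  have := h n
  have := h (n + 1)
  change Module.Projective R (Y.X (n + 1) × Y.X n)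
  infer_instance

theorem Inj.cone {Y : Cx R} (x : R) (h : Inj Y) : Inj (cone x Y) := by
  intro n
  have h1 := h n
  have h2 := h (n + 1)
  change Module.Injective R (Y.X (n + 1) × Y.X n)
  refine ⟨fun A B _ _ _ _ f hf g => ?_⟩
  obtain ⟨s, hs⟩ := h1.out f hf (LinearMap.snd R _ _ ∘ₗ g)
  obtain ⟨t, ht⟩ := h2.out f hf (LinearMap.fst R _ _ ∘ₗ g)
  exact ⟨t.prod s, fun a => Prod.ext (ht a) (hs a)⟩

theorem BddA.cone {Y : Cx R} (x : R) (h : BddA Y) : BddA (cone x Y) := by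
  obtain ⟨b, hb⟩ := h
  refine ⟨b, fun n hn => ?_⟩
  have := hb n hn
  have := hb (n + 1) (by omega)
  change Subsingleton (Y.X (n + 1) × Y.X n)
  infer_instance

theorem BddB.cone {Y : Cx R} (x : R) (h : BddB Y) : BddB (cone x Y) := by
  obtain ⟨b, hb⟩ := h
  refine ⟨b - 1, fun n hn => ?_⟩
  have := hb n (by omega)
  have := hb (n + 1) (by omega)
  change Subsingleton (Y.X (n + 1) × Y.X n)
  infer_instance

/-- partial splitting -/
def Spl (Y : Cx R) (n : ℤ) : Prop :=
  ∃ s : Y.X (n + 1) →ₗ[R] Y.X n, ∀ y, Y.d n (s (Y.d n y)) = Y.d n y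

theorem spl_of_inj {Y : Cx R} (hI : Inj Y) (hb : BddB Y)
    (H : ∀ n, Spl Y n → ∀ z : Y.X (n + 1), Y.d _ z = 0 → ∃ y, Y.d n y = z) (n : ℤ) :
    Spl Y n := by
  obtain ⟨b, hb⟩ := hb
  rcases le_total n b with h | h
  · have := hb n h
    exact ⟨0, fun y => by rw [Subsingleton.elim y 0]; simp⟩
  induction n, h using Int.leInduction with
  | base =>
    have := hb b le_rfl
    exact ⟨0, fun y => by rw [Subsingleton.elim y 0]; simp⟩
  | succ n hn ih =>
    have hex := H n ih
    obtain ⟨s, hs⟩ := ih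
    let e : Y.X (n + 1) →ₗ[R] Y.X (n + 1) := LinearMap.id - Y.d n ∘ₗ s
    have hle : LinearMap.ker (Y.d (n + 1)) ≤ LinearMap.ker e := by
      intro z hz
      obtain ⟨y, rfl⟩ := hex z hz
      simp [e, hs]
    have hinj : Function.Injective ((LinearMap.ker (Y.d (n + 1))).liftQ (Y.d (n + 1)) le_rfl) := by
      rw [← LinearMap.ker_eq_bot]
      exact Submodule.ker_liftQ_eq_bot _ _ _ le_rfl
    obtain ⟨t, ht⟩ := (hI (n + 1)).out _ hinj ((LinearMap.ker (Y.d (n + 1))).liftQ e hle)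
    refine ⟨t, fun y => ?_⟩
    have := ht (Submodule.Quotient.mk y)
    simp only [Submodule.liftQ_apply] at this
    rw [this]
    simp [e, Y.dd]

theorem spl_of_proj {Y : Cx R} (hP : Proj Y) (hb : BddA Y)
    (H : ∀ n, Spl Y (n + 1) → ∀ z : Y.X (n + 1), Y.d _ z = 0 → ∃ y, Y.d n y = z) (n : ℤ) :
    Spl Y n := by
  obtain ⟨b, hb⟩ := hb
  rcases le_total b n with h | h
  · have := hb n h
    exact ⟨0, fun y => by rw [Subsingleton.elim y 0]; simp⟩
  induction n, h using Int.leInductionDown with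
  | base =>
    have := hb b le_rfl
    exact ⟨0, fun y => by rw [Subsingleton.elim y 0]; simp⟩
  | pred n hn ih =>
    obtain ⟨m, rfl⟩ : ∃ m, n = m + 1 := ⟨n - 1, by ring⟩
    rw [add_sub_cancel_right]
    have hex := H m ih
    obtain ⟨s, hs⟩ := ih
    let e : Y.X (m + 1) →ₗ[R] LinearMap.range (Y.d m) :=
      (LinearMap.id - s ∘ₗ Y.d (m + 1)).codRestrict _ (fun y => by
        obtain ⟨w, hw⟩ := hex (y - s (Y.d (m + 1) y)) (by rw [map_sub, hs, sub_self])
        exact ⟨w, by simpa using hw⟩)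
    have := hP (m + 1)
    obtain ⟨t, ht⟩ := Module.projective_lifting_property (Y.d m).rangeRestrict e
      (LinearMap.surjective_rangeRestrict _)
    refine ⟨t, fun y => ?_⟩
    have := congrArg Subtype.val (LinearMap.congr_fun ht (Y.d m y))
    change Y.d m (t (Y.d m y)) = Y.d m y - s (Y.d (m + 1) (Y.d m y)) at this
    rw [this, Y.dd]
    simp

theorem extV_of_ex {I : Ideal R} {Y : Cx R} (hI : Inj Y) (hb : BddB Y) (h : Ex Y) :
    ExtV I Y := by
  intro n z hz hd
  obtain ⟨s, hs⟩ := spl_of_inj hI hb (fun n _ => h n) n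
  obtain ⟨y, rfl⟩ := h n z hd
  exact ⟨s (Y.d n y), fun r hr => by rw [← map_smul, hz r hr, map_zero], hs y⟩

theorem torV_of_ex {I : Ideal R} {Y : Cx R} (hP : Proj Y) (hb : BddA Y) (h : Ex Y) :
    TorV I Y := by
  intro n z hz
  obtain ⟨s, hs⟩ := spl_of_proj hP hb (fun n _ => h n) (n + 1)
  obtain ⟨y, hy⟩ := h n (z - s (Y.d _ z)) (by rw [map_sub, hs, sub_self])
  refine ⟨y, ?_⟩
  rw [hy, sub_sub_cancel]
  have := Submodule.mem_map_of_mem (f := s) hz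
  rw [Submodule.map_smul''] at this
  exact Submodule.smul_mono le_rfl le_top this

def Tors (I : Ideal R) (Y : Cx R) : Prop :=
  ∀ n, ∃ N : ℕ, ∀ r ∈ I ^ N, ∀ z : Y.X (n + 1), Y.d _ z = 0 → ∃ y, Y.d n y = r • z

theorem tors_of_nil {I : Ideal R} {Y : Cx R} (S : Finset R) (hS : Ideal.span (S : Set R) = I)
    (h : ∀ x ∈ S, Nil x Y) : Tors I Y := by
  intro n
  let A : Ideal R := (LinearMap.range (Y.d n)).colon (LinearMap.ker (Y.d (n + 1)) : Set _)
  have hA : ∀ r, r ∈ A ↔ ∀ z : Y.X (n + 1), Y.d _ z = 0 → ∃ y, Y.d n y = r • z := by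
    intro r
    simp [A, Submodule.mem_colon]
  have hle : I ≤ A.radical := by
    rw [← hS, Ideal.span_le]
    intro x hx
    obtain ⟨k, hk⟩ := h x hx
    exact ⟨k, (hA _).2 (hk n)⟩
  obtain ⟨N, hN⟩ := Ideal.exists_pow_le_of_le_radical_of_fg hle ⟨S, hS⟩
  exact ⟨N, fun r hr => (hA r).1 (hN hr)⟩

theorem ex_of_extV {I : Ideal R} {Y : Cx R} (hI : Inj Y) (hb : BddB Y) (hT : Tors I Y)
    (h : ExtV I Y) : Ex Y := by
  have H : ∀ n, Spl Y n → ∀ z : Y.X (n + 1), Y.d _ z = 0 → ∃ y, Y.d n y = z := by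
    rintro n ⟨s, hs⟩
    have step : ∀ z : Y.X (n + 1), Y.d _ z = 0 → (∀ r ∈ I, ∃ y, Y.d n y = r • z) →
        ∃ y, Y.d n y = z := by
      intro z hz hr
      obtain ⟨y, -, hy⟩ := h n (z - Y.d n (s z)) (fun r hrI => by
        obtain ⟨w, hw⟩ := hr r hrI
        rw [smul_sub, ← map_smul, ← map_smul, ← hw, hs, sub_self]) (by
        rw [map_sub, hz, Y.dd, sub_self])
      exact ⟨y + s z, by rw [map_add, hy, sub_add_cancel]⟩
    have key : ∀ N : ℕ, ∀ z : Y.X (n + 1), Y.d _ z = 0 →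
        (∀ r ∈ I ^ N, ∃ y, Y.d n y = r • z) → ∃ y, Y.d n y = z := by
      intro N
      induction N with
      | zero =>
        intro z hz hr
        simpa using hr 1 (by simp)
      | succ N ih =>
        intro z hz hr
        refine step z hz fun a ha => ih _ (by rw [map_smul, hz, smul_zero]) fun r hrN => ?_
        obtain ⟨y, hy⟩ := hr (r * a) (by rw [pow_succ]; exact Ideal.mul_mem_mul hrN ha)
        exact ⟨y, by rw [hy, smul_smul]⟩
    obtain ⟨N, hN⟩ := hT n
    exact fun z hz => key N z hz fun r hr => hN r hr z hz
  exact fun n => H n (spl_of_inj hI hb H n)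

theorem ex_of_torV {I : Ideal R} {Y : Cx R} (hP : Proj Y) (hb : BddA Y) (hT : Tors I Y)
    (h : TorV I Y) : Ex Y := by
  have H : ∀ n, Spl Y (n + 1) → ∀ z : Y.X (n + 1), Y.d _ z = 0 → ∃ y, Y.d n y = z := by
    rintro n ⟨s, hs⟩
    let K := LinearMap.ker (Y.d (n + 1))
    let B := LinearMap.range (Y.d n)
    have hBK : B ≤ K := by
      rintro _ ⟨y, rfl⟩
      exact Y.dd n y
    let e : Y.X (n + 1) →ₗ[R] Y.X (n + 1) := LinearMap.id - s ∘ₗ Y.d (n + 1)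
    have heK : Submodule.map e ⊤ ≤ K := by
      rintro _ ⟨y, -, rfl⟩
      change Y.d (n + 1) (y - s (Y.d (n + 1) y)) = 0
      rw [map_sub, hs, sub_self]
    have step : K ≤ I • K ⊔ B := by
      intro z hz
      obtain ⟨y, hy⟩ := h n z (by rw [show Y.d (n + 1) z = 0 from hz]; exact zero_mem _)
      have h1 := Submodule.mem_map_of_mem (f := e) hy
      rw [Submodule.map_smul''] at h1
      have h2 := Submodule.smul_mono le_rfl heK h1
      have h3 : e (z - Y.d n y) = z - Y.d n y := by
        change (z - Y.d n y) - s (Y.d (n + 1) (z - Y.d n y)) = _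
        rw [map_sub, show Y.d (n + 1) z = 0 from hz, Y.dd]
        simp
      rw [h3] at h2
      rw [← sub_add_cancel z (Y.d n y)]
      exact Submodule.add_mem_sup h2 ⟨y, rfl⟩
    have key : ∀ N : ℕ, K ≤ I ^ N • K ⊔ B := by
      intro N
      induction N with
      | zero => simp
      | succ N ih =>
        refine ih.trans (sup_le ?_ le_sup_right)
        refine (Submodule.smul_mono le_rfl step).trans ?_
        rw [Submodule.smul_sup, ← Submodule.mul_smul, ← pow_succ]
        exact sup_le_sup le_rfl Submodule.smul_le_right
    obtain ⟨N, hN⟩ := hT n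
    intro z hz
    have : I ^ N • K ⊔ B ≤ B := sup_le (Submodule.smul_le.2 fun r hr z hz => hN r hr z hz) le_rfl
    exact this (key N hz)
  exact fun n => H n (spl_of_proj hP hb H (n + 1))

def kos (l : List R) (Y : Cx R) : Cx R := l.foldr cone Y

theorem core {I : Ideal R} (hI : I.FG) {A B C : Cx R} (h : SES A B C) (hB : Ex B)
    (hA1 : Inj A) (hA2 : BddB A) (hC1 : Proj C) (hC2 : BddA C) :
    TorV I C ↔ ExtV I A := by
  obtain ⟨S, hS⟩ := hI
  have hSI : ∀ x ∈ S.toList, x ∈ I := fun x hx => hS ▸ Ideal.subset_span (by simpa using hx)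
  have hnil : ∀ (Y : Cx R) (l : List R), ∀ x ∈ l, Nil x (kos l Y) := by
    intro Y l
    induction l with
    | nil => simp
    | cons w l ih =>
      intro x hx
      rcases List.mem_cons.1 hx with rfl | hx
      · exact Nil.cone_self _ _
      · exact (ih x hx).cone w
  have hT : ∀ Y : Cx R, Tors I (kos S.toList Y) := fun Y =>
    tors_of_nil S hS fun x hx => hnil Y _ x (by simpa using hx)
  have H : ∀ l : List R, (∀ x ∈ l, x ∈ I) → SES (kos l A) (kos l B) (kos l C) ∧ Ex (kos l B) ∧
      Inj (kos l A) ∧ BddB (kos l A) ∧ Proj (kos l C) ∧ BddA (kos l C) ∧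
      (TorV I (kos l C) ↔ TorV I C) ∧ (ExtV I (kos l A) ↔ ExtV I A) := by
    intro l
    induction l with
    | nil => intro _; exact ⟨h, hB, hA1, hA2, hC1, hC2, Iff.rfl, Iff.rfl⟩
    | cons w l ih =>
      intro hl
      obtain ⟨h1, h2, h3, h4, h5, h6, h7, h8⟩ := ih fun x hx => hl x (by simp [hx])
      have hw := hl w (by simp)
      exact ⟨h1.cone w, h2.cone w, h3.cone w, h4.cone w, h5.cone w, h6.cone w,
        (torV_cone_iff hw _).trans h7, (extV_cone_iff hw _).trans h8⟩
  obtain ⟨h1, h2, h3, h4, h5, h6, h7, h8⟩ := H _ hSI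
  rw [← h7, ← h8]
  exact ⟨fun t => extV_of_ex h3 h4 ((h1.ex_iff h2).2 (ex_of_torV h5 h6 (hT _) t)),
    fun t => torV_of_ex h5 h6 ((h1.ex_iff h2).1 (ex_of_extV h3 h4 (hT _) t))⟩

end Cx

namespace Cx

variable {R : Type u} [CommRing R]

def spX (A B : ℕ → ModuleCat.{u} R) : ℤ → ModuleCat.{u} R
  | .ofNat n => A n
  | .negSucc n => B n

def spd (A B : ℕ → ModuleCat.{u} R) (a : ∀ n, A n →ₗ[R] A (n + 1))
    (b : ∀ n, B (n + 1) →ₗ[R] B n) (c : B 0 →ₗ[R] A 0) :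
    ∀ n : ℤ, spX A B n →ₗ[R] spX A B (n + 1)
  | .ofNat n => a n
  | .negSucc 0 => c
  | .negSucc (n + 1) => b n

def sp (A B : ℕ → ModuleCat.{u} R) (a : ∀ n, A n →ₗ[R] A (n + 1))
    (b : ∀ n, B (n + 1) →ₗ[R] B n) (c : B 0 →ₗ[R] A 0)
    (ha : ∀ n x, a (n + 1) (a n x) = 0) (hb : ∀ n x, b n (b (n + 1) x) = 0)
    (hca : ∀ x, a 0 (c x) = 0) (hbc : ∀ x, c (b 0 x) = 0) : Cx R where
  X := spX A B
  d := spd A B a b c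
  dd
  | .ofNat n, x => ha n x
  | .negSucc 0, x => hca x
  | .negSucc 1, x => hbc x
  | .negSucc (n + 2), x => hb n x

def zr : ℕ → ModuleCat.{u} R := fun _ => ModuleCat.of R PUnit.{u + 1}

instance (n : ℕ) : Subsingleton (zr (R := R) n) :=
  inferInstanceAs (Subsingleton PUnit)

theorem triv_mem (A : ModuleCat.{u} R) [Subsingleton A] (S : Submodule R A) (z : A) : z ∈ S := by
  rw [Subsingleton.elim z 0]
  exact zero_mem S

theorem main_core {I : Ideal R} (hI : I.FG) (A B : ℕ → ModuleCat.{u} R)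
    (a : ∀ n, A n →ₗ[R] A (n + 1))
    (b : ∀ n, B (n + 1) →ₗ[R] B n) (c : B 0 →ₗ[R] A 0)
    (ha : ∀ n x, a (n + 1) (a n x) = 0) (hb : ∀ n x, b n (b (n + 1) x) = 0)
    (hca : ∀ x, a 0 (c x) = 0) (hbc : ∀ x, c (b 0 x) = 0)
    (ea : ∀ n x, a (n + 1) x = 0 → ∃ y, a n y = x)
    (eb : ∀ n x, b n x = 0 → ∃ y, b (n + 1) y = x)
    (eca : ∀ x, a 0 x = 0 → ∃ y, c y = x)
    (ebc : ∀ x, c x = 0 → ∃ y, b 0 y = x)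
    (iA : ∀ n, Module.Injective R (A n)) (pB : ∀ n, Module.Projective R (B n)) :
    ((∀ z : B 0, ∃ y, z - b 0 y ∈ (I • ⊤ : Submodule R (B 0))) ∧
      (∀ n, ∀ z : B (n + 1), b n z ∈ (I • ⊤ : Submodule R (B n)) →
        ∃ y, z - b (n + 1) y ∈ (I • ⊤ : Submodule R (B (n + 1))))) ↔
    ((∀ z : A 0, (∀ r ∈ I, r • z = 0) → a 0 z = 0 → z = 0) ∧
      (∀ n, ∀ z : A (n + 1), (∀ r ∈ I, r • z = 0) → a (n + 1) z = 0 →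
        ∃ y, (∀ r ∈ I, r • y = 0) ∧ a n y = z)) := by
  let W := sp A B a b c ha hb hca hbc
  let J := sp A zr a (fun _ => 0) 0 ha (fun _ _ => rfl) (fun _ => map_zero _) (fun _ => rfl)
  let Q := sp zr B (fun _ => 0) b 0 (fun _ _ => rfl) hb (fun _ => rfl) (fun _ => rfl)
  have hW : Ex W := by
    rintro ((_ | n) | (_ | _ | n)) z hz
    · exact ea 0 z hz
    · exact ea (n + 1) z hz
    · exact eca z hz
    · exact ebc z hz
    · exact eb n z hz
  have hs : SES J W Q := by
    refine ⟨fun n => match n with | .ofNat n => LinearMap.id | .negSucc n => 0,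
      fun n => match n with | .ofNat n => 0 | .negSucc n => LinearMap.id, ?_, ?_, ?_, ?_, ?_, ?_⟩
    · rintro (n | (_ | n)) x
      · rfl
      · exact (map_zero c).symm
      · exact (map_zero (b n)).symm
    · rintro (n | (_ | n)) x
      · rfl
      · rfl
      · rfl
    · rintro (n | n) x h
      · exact h
      · exact Subsingleton.elim (α := zr (R := R) n) _ _
    · rintro (n | n) x
      · exact ⟨(0 : A n), Subsingleton.elim (α := zr (R := R) n) _ _⟩
      · exact ⟨x, rfl⟩
    · rintro (n | n) x
      · rfl
      · rfl
    · rintro (n | n) x h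
      · exact ⟨x, rfl⟩
      · exact ⟨(0 : zr (R := R) n), h.symm⟩
  have hJ1 : Inj J := by
    rintro (n | n)
    · exact iA n
    · refine ⟨fun _ _ _ _ _ _ f hf g => ⟨0, fun x => ?_⟩⟩
      exact Subsingleton.elim (α := zr (R := R) n) _ _
  have hJ2 : BddB J := by
    refine ⟨-1, fun n hn => ?_⟩
    match n, hn with
    | .ofNat n, hn => exact absurd hn (by have := Int.natCast_nonneg n; change ¬ ((n : ℤ) ≤ -1); omega)
    | .negSucc n, _ => exact inferInstanceAs (Subsingleton (zr (R := R) n))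
  have hQ1 : Proj Q := by
    rintro (n | n)
    · exact inferInstanceAs (Module.Projective R PUnit.{u + 1})
    · exact pB n
  have hQ2 : BddA Q := by
    refine ⟨0, fun n hn => ?_⟩
    match n, hn with
    | .ofNat n, _ => exact inferInstanceAs (Subsingleton (zr (R := R) n))
    | .negSucc n, hn => exact absurd hn (by have := Int.negSucc_lt_zero n; omega)
  have key := core hI hs hW hJ1 hJ2 hQ1 hQ2
  have hT : TorV I Q ↔ ((∀ z : B 0, ∃ y, z - b 0 y ∈ (I • ⊤ : Submodule R (B 0))) ∧
      (∀ n, ∀ z : B (n + 1), b n z ∈ (I • ⊤ : Submodule R (B n)) →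
        ∃ y, z - b (n + 1) y ∈ (I • ⊤ : Submodule R (B (n + 1))))) := by
    constructor
    · intro h
      exact ⟨fun z => h (Int.negSucc 1) z (zero_mem _), fun n z hz => h (Int.negSucc (n + 2)) z hz⟩
    · rintro ⟨h0, h1⟩ (n | (_ | _ | n)) z hz
      · exact ⟨0, triv_mem (zr (R := R) (n + 1)) _ _⟩
      · exact ⟨0, triv_mem (zr (R := R) 0) _ _⟩
      · exact h0 z
      · exact h1 n z hz
  have hE : ExtV I J ↔ ((∀ z : A 0, (∀ r ∈ I, r • z = 0) → a 0 z = 0 → z = 0) ∧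
      (∀ n, ∀ z : A (n + 1), (∀ r ∈ I, r • z = 0) → a (n + 1) z = 0 →
        ∃ y, (∀ r ∈ I, r • y = 0) ∧ a n y = z)) := by
    constructor
    · intro h
      refine ⟨fun z hz hd => ?_, fun n z hz hd => h (Int.ofNat n) z hz hd⟩
      obtain ⟨y, -, hy⟩ := h (Int.negSucc 0) z hz hd
      exact hy.symm
    · rintro ⟨h0, h1⟩ (n | (_ | n)) z hz hd
      · exact h1 n z hz hd
      · exact ⟨(0 : zr (R := R) 0), fun r _ => rfl, (h0 z hz hd).symm⟩
      · exact ⟨(0 : zr (R := R) (n + 1)), fun r _ => rfl,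
          Subsingleton.elim (α := zr (R := R) n) _ _⟩
  exact hT.symm.trans (key.trans hE)

end Cx

section bridge

variable {R : Type u} [CommRing R]

open TensorProduct in
theorem one_tmul_eq_zero_iff (I : Ideal R) {B : Type u} [AddCommGroup B] [Module R B] (b : B) :
    ((1 : R ⧸ I) ⊗ₜ[R] b) = 0 ↔ b ∈ (I • ⊤ : Submodule R B) := by
  rw [← (quotTensorEquivQuotSMul B I).map_eq_zero_iff, quotTensorEquivQuotSMul_mk_one_tmul,
    Submodule.Quotient.mk_eq_zero]

open TensorProduct in
theorem exists_one_tmul (I : Ideal R) {B : Type u} [AddCommGroup B] [Module R B]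
    (t : (R ⧸ I) ⊗[R] B) : ∃ b : B, t = 1 ⊗ₜ[R] b := by
  obtain ⟨b, hb⟩ := Submodule.Quotient.mk_surjective _ (quotTensorEquivQuotSMul B I t)
  refine ⟨b, (quotTensorEquivQuotSMul B I).injective ?_⟩
  rw [quotTensorEquivQuotSMul_mk_one_tmul, hb]

open MonoidalCategory in
theorem tensor_exact_iff (I : Ideal R) (S : ShortComplex (ModuleCat.{u} R)) :
    (S.map ((tensoringLeft (ModuleCat.{u} R)).obj (ModuleCat.of R (R ⧸ I)))).Exact ↔
      ∀ z : S.X₂, S.g z ∈ (I • ⊤ : Submodule R S.X₃) →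
        ∃ y, z - S.f y ∈ (I • ⊤ : Submodule R S.X₂) := by
  rw [ShortComplex.moduleCat_exact_iff]
  constructor
  · intro h z hz
    obtain ⟨t, ht⟩ := h ((1 : R ⧸ I) ⊗ₜ[R] z) ((one_tmul_eq_zero_iff I (S.g z)).2 hz)
    obtain ⟨y, rfl⟩ := exists_one_tmul I (B := S.X₁) t
    change (1 : R ⧸ I) ⊗ₜ[R] (S.f y) = (1 : R ⧸ I) ⊗ₜ[R] z at ht
    refine ⟨y, (one_tmul_eq_zero_iff I _).1 ?_⟩
    rw [TensorProduct.tmul_sub, ht, sub_self]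
  · intro h t ht
    obtain ⟨z, rfl⟩ := exists_one_tmul I (B := S.X₂) t
    obtain ⟨y, hy⟩ := h z ((one_tmul_eq_zero_iff I _).1 ht)
    refine ⟨(1 : R ⧸ I) ⊗ₜ[R] y, ?_⟩
    change (1 : R ⧸ I) ⊗ₜ[R] (S.f y) = (1 : R ⧸ I) ⊗ₜ[R] z
    have := (one_tmul_eq_zero_iff I _).2 hy
    rw [TensorProduct.tmul_sub, sub_eq_zero] at this
    exact this.symm

open MonoidalCategory in
theorem tor_sub_iff (I : Ideal R) {M : ModuleCat.{u} R} (P : ProjectiveResolution M) (n k : ℕ)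
    (hk : (ComplexShape.down ℕ).next n = k) :
    Subsingleton (TorMod R n (ModuleCat.of R (R ⧸ I)) M) ↔
      ∀ z : P.complex.X n, P.complex.d n k z ∈ (I • ⊤ : Submodule R (P.complex.X k)) →
        ∃ y, z - P.complex.d (n + 1) n y ∈ (I • ⊤ : Submodule R (P.complex.X n)) := by
  rw [← ModuleCat.isZero_iff_subsingleton]
  let F := (tensoringLeft (ModuleCat.{u} R)).obj (ModuleCat.of R (R ⧸ I))
  have e : TorMod R n (ModuleCat.of R (R ⧸ I)) M ≅ _ := P.isoLeftDerivedObj F n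
  rw [e.isZero_iff]
  have h1 := HomologicalComplex.exactAt_iff_isZero_homology
    ((F.mapHomologicalComplex (ComplexShape.down ℕ)).obj P.complex) n
  have h2 := HomologicalComplex.exactAt_iff'
    ((F.mapHomologicalComplex (ComplexShape.down ℕ)).obj P.complex) (n + 1) n k (by simp) hk
  exact h1.symm.trans (h2.trans (tensor_exact_iff I (P.complex.sc' (n + 1) n k)))

end bridge

section bridge2

variable {R : Type u} [CommRing R]

theorem ext_sub_iff {X M : ModuleCat.{u} R} (P : ProjectiveResolution X) (n k : ℕ)
    (hk : (ComplexShape.down ℕ).next n = k) :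
    Subsingleton (ExtMod R n X M) ↔
      ∀ f : P.complex.X n ⟶ M, P.complex.d (n + 1) n ≫ f = 0 →
        ∃ g : P.complex.X k ⟶ M, P.complex.d n k ≫ g = f := by
  rw [← ModuleCat.isZero_iff_subsingleton]
  have e : ExtMod R n X M ≅ _ := P.isoExt n M
  rw [e.isZero_iff]
  have h1 := HomologicalComplex.exactAt_iff_isZero_homology (P.complex.linearYonedaObj R M) n
  have h2 := HomologicalComplex.exactAt_iff' (P.complex.linearYonedaObj R M) k n (n + 1)
    hk (by simp)
  refine h1.symm.trans (h2.trans ?_)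
  rw [ShortComplex.moduleCat_exact_iff]
  rfl

theorem ext_succ_iff {X M : ModuleCat.{u} R} (J : InjectiveResolution M) (n : ℕ) :
    Subsingleton (ExtMod R (n + 1) X M) ↔
      ∀ f : X ⟶ J.cocomplex.X (n + 1), f ≫ J.cocomplex.d (n + 1) (n + 2) = 0 →
        ∃ g : X ⟶ J.cocomplex.X n, g ≫ J.cocomplex.d n (n + 1) = f := by
  let P := projectiveResolution X
  rw [ext_sub_iff P (n + 1) n (by simp)]
  trans Subsingleton (Abelian.Ext X M (n + 1))
  · constructor
    · intro h
      refine subsingleton_of_forall_eq 0 fun α => ?_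
      obtain ⟨f, hf, rfl⟩ := P.extMk_surjective α (n + 2) rfl
      exact (P.extMk_eq_zero_iff f (n + 2) rfl hf n rfl).2 (h f hf)
    · intro h f hf
      exact (P.extMk_eq_zero_iff f (n + 2) rfl hf n rfl).1 (Subsingleton.elim _ _)
  · constructor
    · intro h f hf
      exact (J.extMk_eq_zero_iff f (n + 2) rfl hf n rfl).1 (Subsingleton.elim _ _)
    · intro h
      refine subsingleton_of_forall_eq 0 fun α => ?_
      obtain ⟨f, hf, rfl⟩ := J.extMk_surjective α (n + 2) rfl
      exact (J.extMk_eq_zero_iff f (n + 2) rfl hf n rfl).2 (h f hf)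

theorem proj_exact {M : ModuleCat.{u} R} (P : ProjectiveResolution M) :
    (ShortComplex.mk (P.complex.d 1 0) (P.π.f 0) P.complex_d_comp_π_f_zero).Exact :=
  ShortComplex.exact_of_g_is_cokernel _ P.isColimitCokernelCofork

theorem inj_exact {M : ModuleCat.{u} R} (J : InjectiveResolution M) :
    (ShortComplex.mk (J.ι.f 0) (J.cocomplex.d 0 1) J.ι_f_zero_comp_complex_d).Exact :=
  ShortComplex.exact_of_f_is_kernel _ J.isLimitKernelFork

theorem aux_proj {A B X M : ModuleCat.{u} R} (d : A ⟶ B) (p : B ⟶ X) (w : d ≫ p = 0)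
    (hp : Epi p) (he : (ShortComplex.mk d p w).Exact) :
    (∀ f : B ⟶ M, d ≫ f = 0 → f = 0) ↔ ∀ f : X ⟶ M, f = 0 := by
  constructor
  · intro h f
    have := h (p ≫ f) (by rw [← Category.assoc, w, Limits.zero_comp])
    exact (cancel_epi p).1 (this.trans Limits.comp_zero.symm)
  · intro h f hf
    have : Epi (ShortComplex.mk d p w).g := hp
    have h2 := he.g_desc f hf
    rw [← h2, h (he.desc f hf), Limits.comp_zero]

theorem aux_inj {A B X M : ModuleCat.{u} R} (i : M ⟶ A) (d : A ⟶ B) (w : i ≫ d = 0)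
    (hp : Mono i) (he : (ShortComplex.mk i d w).Exact) :
    (∀ f : X ⟶ M, f = 0) ↔ (∀ f : X ⟶ A, f ≫ d = 0 → f = 0) := by
  constructor
  · intro h f hf
    have : Mono (ShortComplex.mk i d w).f := hp
    have h2 := he.lift_f f hf
    rw [← h2, h (he.lift f hf), Limits.zero_comp]
  · intro h f
    have := h (f ≫ i) (by rw [Category.assoc, w, Limits.comp_zero])
    exact (cancel_mono i).1 (this.trans Limits.zero_comp.symm)

theorem ext_zero_iff {X M : ModuleCat.{u} R} (J : InjectiveResolution M) :
    Subsingleton (ExtMod R 0 X M) ↔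
      ∀ f : X ⟶ J.cocomplex.X 0, f ≫ J.cocomplex.d 0 1 = 0 → f = 0 := by
  let P := projectiveResolution X
  rw [ext_sub_iff P 0 0 (by simp)]
  have h1 : (∀ f : P.complex.X 0 ⟶ M, P.complex.d 1 0 ≫ f = 0 → f = 0) ↔ ∀ f : X ⟶ M, f = 0 :=
    aux_proj (P.complex.d 1 0) (P.π.f 0) P.complex_d_comp_π_f_zero
      (inferInstanceAs (Epi (P.π.f 0))) (proj_exact P)
  have h2 : (∀ f : X ⟶ M, f = 0) ↔
      ∀ f : X ⟶ J.cocomplex.X 0, f ≫ J.cocomplex.d 0 1 = 0 → f = 0 :=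
    aux_inj (J.ι.f 0) (J.cocomplex.d 0 1) J.ι_f_zero_comp_complex_d
      (inferInstanceAs (Mono (J.ι.f 0))) (inj_exact J)
  refine Iff.trans ?_ (h1.trans h2)
  have h0 : P.complex.d 0 0 = 0 := P.complex.shape 0 0 (by simp)
  constructor
  · intro h f hf
    obtain ⟨g, hg⟩ := h f hf
    rw [← hg, h0, Limits.zero_comp]
  · intro h f hf
    exact ⟨0, by rw [h f hf, Limits.comp_zero]⟩

/-- the map out of `R/I` given by an element killed by `I` -/
def homOf (I : Ideal R) {A : ModuleCat.{u} R} (z : A) (hz : ∀ r ∈ I, r • z = 0) :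
    ModuleCat.of R (R ⧸ I) ⟶ A :=
  ModuleCat.ofHom (Submodule.liftQ I (LinearMap.toSpanSingleton R A z) (fun r hr => hz r hr))

theorem homOf_one (I : Ideal R) {A : ModuleCat.{u} R} (z : A) (hz : ∀ r ∈ I, r • z = 0) :
    homOf I z hz (1 : R ⧸ I) = z := by
  change (1 : R) • z = z
  simp

theorem hom_ext_one (I : Ideal R) {A : ModuleCat.{u} R} (f g : ModuleCat.of R (R ⧸ I) ⟶ A)
    (h : f (1 : R ⧸ I) = g (1 : R ⧸ I)) : f = g := by
  apply ModuleCat.hom_ext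
  apply Submodule.linearMap_qext
  apply LinearMap.ext_ring
  exact h

theorem hom_killed (I : Ideal R) {A : ModuleCat.{u} R} (f : ModuleCat.of R (R ⧸ I) ⟶ A) :
    ∀ r ∈ I, r • f (1 : R ⧸ I) = 0 := by
  intro r hr
  have h : r • (1 : R ⧸ I) = 0 := by
    rw [Algebra.smul_def, mul_one]
    exact Ideal.Quotient.eq_zero_iff_mem.2 hr
  have := (f.hom.map_smul r (1 : R ⧸ I)).symm
  refine this.trans ?_
  exact (congrArg f.hom h).trans f.hom.map_zero

end bridge2

theorem stmt1 (R : Type u) [CommRing R] [IsNoetherianRing R] (I : Ideal R)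
    (M : Type u) [AddCommGroup M] [Module R M] :
    (∀ n : ℕ, Subsingleton (TorMod R n (ModuleCat.of R (R ⧸ I)) (ModuleCat.of R M))) ↔
      (∀ n : ℕ, Subsingleton (ExtMod R n (ModuleCat.of R (R ⧸ I)) (ModuleCat.of R M))) := by
  let P := projectiveResolution (ModuleCat.of R M)
  let J := injectiveResolution (ModuleCat.of R M)
  have pe := (ShortComplex.moduleCat_exact_iff _).1 (proj_exact P)
  have je := (ShortComplex.moduleCat_exact_iff _).1 (inj_exact J)
  have ps : Function.Surjective (P.π.f 0).hom :=
    (ModuleCat.epi_iff_surjective _).1 (inferInstanceAs (Epi (P.π.f 0)))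
  have ji : Function.Injective (J.ι.f 0).hom :=
    (ModuleCat.mono_iff_injective _).1 (inferInstanceAs (Mono (J.ι.f 0)))
  have pz : ∀ x, (P.π.f 0).hom ((P.complex.d 1 0).hom x) = 0 := fun x =>
    LinearMap.congr_fun (congrArg ModuleCat.Hom.hom P.complex_d_comp_π_f_zero) x
  have jz : ∀ x, (J.cocomplex.d 0 1).hom ((J.ι.f 0).hom x) = 0 := fun x =>
    LinearMap.congr_fun (congrArg ModuleCat.Hom.hom J.ι_f_zero_comp_complex_d) x
  have main := Cx.main_core (IsNoetherian.noetherian I)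
    (fun n => J.cocomplex.X n) (fun n => P.complex.X n)
    (fun n => (J.cocomplex.d n (n + 1)).hom) (fun n => (P.complex.d (n + 1) n).hom)
    ((J.ι.f 0).hom ∘ₗ (P.π.f 0).hom)
    (fun n x => LinearMap.congr_fun (congrArg ModuleCat.Hom.hom
      (J.cocomplex.d_comp_d n (n + 1) (n + 2))) x)
    (fun n x => LinearMap.congr_fun (congrArg ModuleCat.Hom.hom
      (P.complex.d_comp_d (n + 2) (n + 1) n)) x)
    (fun x => jz _)
    (fun x => (congrArg (J.ι.f 0).hom (pz x)).trans (map_zero (J.ι.f 0).hom))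
    (fun n => (ShortComplex.moduleCat_exact_iff _).1 (J.exact_succ n))
    (fun n => (ShortComplex.moduleCat_exact_iff _).1 (P.exact_succ n))
    (fun x hx => by
      obtain ⟨m, hm⟩ := je x hx
      obtain ⟨y, hy⟩ := ps m
      exact ⟨y, (congrArg (J.ι.f 0).hom hy).trans hm⟩)
    (fun x hx => pe x (ji (hx.trans (map_zero (J.ι.f 0).hom).symm)))
    (fun n => (Module.injective_iff_injective_object R _).2 (J.injective n))
    (fun n => (IsProjective.iff_projective _).2 (P.projective n))
  refine Iff.trans ?_ (main.trans ?_)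
  · constructor
    · intro h
      refine ⟨fun z => ?_, fun n z hz => ?_⟩
      · exact (tor_sub_iff I P 0 0 (by simp)).1 (h 0) z (by
          rw [P.complex.shape 0 0 (by simp)]; exact zero_mem _)
      · exact (tor_sub_iff I P (n + 1) n (by simp)).1 (h (n + 1)) z hz
    · intro h n
      cases n with
      | zero => exact (tor_sub_iff I P 0 0 (by simp)).2 fun z _ => h.1 z
      | succ n => exact (tor_sub_iff I P (n + 1) n (by simp)).2 fun z hz => h.2 n z hz
  constructor
  · rintro ⟨h0, h1⟩ (_ | n)
    · refine (ext_zero_iff J).2 fun f hf => hom_ext_one I _ _ ?_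
      exact h0 (f (1 : R ⧸ I)) (hom_killed I f)
        (LinearMap.congr_fun (congrArg ModuleCat.Hom.hom hf) (1 : R ⧸ I))
    · refine (ext_succ_iff J n).2 fun f hf => ?_
      obtain ⟨y, hy, hyf⟩ := h1 n (f (1 : R ⧸ I)) (hom_killed I f)
        (LinearMap.congr_fun (congrArg ModuleCat.Hom.hom hf) (1 : R ⧸ I))
      refine ⟨homOf I y hy, hom_ext_one I _ _ ?_⟩
      exact (congrArg (J.cocomplex.d n (n + 1)).hom (homOf_one I y hy)).trans hyf
  · intro h
    refine ⟨fun z hz hd => ?_, fun n z hz hd => ?_⟩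
    · have := (ext_zero_iff J).1 (h 0) (homOf I z hz) (hom_ext_one I _ _
        ((congrArg (J.cocomplex.d 0 1).hom (homOf_one I z hz)).trans hd))
      rw [← homOf_one I z hz, this]
      rfl
    · obtain ⟨g, hg⟩ := (ext_succ_iff J n).1 (h (n + 1)) (homOf I z hz) (hom_ext_one I _ _
        ((congrArg (J.cocomplex.d (n + 1) (n + 2)).hom (homOf_one I z hz)).trans hd))
      refine ⟨g (1 : R ⧸ I), hom_killed I g, ?_⟩
      exact (LinearMap.congr_fun (congrArg ModuleCat.Hom.hom hg) (1 : R ⧸ I)).trans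
        (homOf_one I z hz)
end
end

section
/- Let (R, m) be a commutative Noetherian local ring, I an ideal of R, and M an R-module. If Tor_i^R(R/I, M) is finitely generated for all 0 ≤ i ≤ cd(I, R), then Tor_i^R(R/I, M) is finitely generated for all i ≥ 0. -/
open CategoryTheory

noncomputable section

universe u

namespace Stmt3Aux

open CategoryTheory.Abelian Opposite

variable {R : Type u} [CommRing R]

/-- the system `R / I ^ t` -/
abbrev Q (I : Ideal R) : ℕᵒᵖ ⥤ ModuleCat.{u} R :=
  localCohomology.ringModIdeals (localCohomology.idealPowersDiagram I)

/-- transition maps -/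
abbrev tr (I : Ideal R) {t s : ℕ} (h : t ≤ s) : (Q I).obj (op s) ⟶ (Q I).obj (op t) :=
  (Q I).map (homOfLE h).op

/-- all classes die -/
def V (I : Ideal R) (j : ℕ) (N : ModuleCat.{u} R) : Prop :=
  ∀ (t : ℕ) (e : Abelian.Ext ((Q I).obj (op t)) N j), ∃ (s : ℕ) (h : t ≤ s),
    (Abelian.Ext.mk₀ (tr I h)).comp e (zero_add _) = 0

lemma tr_comp (I : Ideal R) {t s r : ℕ} (h : t ≤ s) (h' : s ≤ r) :
    tr I h' ≫ tr I h = tr I (h.trans h') := by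
  rw [← Functor.map_comp]; rfl

lemma tr_tr (I : Ideal R) {N : ModuleCat.{u} R} {j : ℕ} {t s r : ℕ} (h : t ≤ s) (h' : s ≤ r)
    (e : Abelian.Ext ((Q I).obj (op t)) N j) :
    (Abelian.Ext.mk₀ (tr I h')).comp ((Abelian.Ext.mk₀ (tr I h)).comp e (zero_add _)) (zero_add _)
      = (Abelian.Ext.mk₀ (tr I (h.trans h'))).comp e (zero_add _) := by
  rw [Ext.mk₀_comp_mk₀_assoc, tr_comp]

lemma V_mid (I : Ideal R) (j : ℕ) {S : ShortComplex (ModuleCat.{u} R)} (hS : S.ShortExact)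
    (h1 : V I j S.X₁) (h3 : V I j S.X₃) : V I j S.X₂ := by
  intro t e
  obtain ⟨s, hs, he⟩ := h3 t (e.comp (Ext.mk₀ S.g) (add_zero _))
  rw [← Ext.comp_assoc_of_third_deg_zero] at he
  obtain ⟨e1, he1⟩ := Ext.covariant_sequence_exact₂ _ hS _ he
  obtain ⟨r, hr, h0⟩ := h1 s e1
  refine ⟨r, hs.trans hr, ?_⟩
  rw [← tr_tr I hs hr, ← he1, ← Ext.comp_assoc_of_third_deg_zero, h0, Ext.zero_comp]

lemma V_right (I : Ideal R) (j : ℕ) {S : ShortComplex (ModuleCat.{u} R)} (hS : S.ShortExact)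
    (h1 : V I (j + 1) S.X₁) (h2 : V I j S.X₂) : V I j S.X₃ := by
  intro t e
  obtain ⟨s, hs, he⟩ := h1 t (e.comp hS.extClass rfl)
  rw [← Ext.comp_assoc _ _ _ (zero_add _) rfl (by lia)] at he
  obtain ⟨e1, he1⟩ := Ext.covariant_sequence_exact₃ _ hS _ rfl he
  obtain ⟨r, hr, h0⟩ := h2 s e1
  refine ⟨r, hs.trans hr, ?_⟩
  rw [← tr_tr I hs hr, ← he1, ← Ext.comp_assoc_of_third_deg_zero, h0, Ext.zero_comp]

lemma V_of_subsingleton (I : Ideal R) (j : ℕ) (N : ModuleCat.{u} R) [Subsingleton N] :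
    V I j N := by
  intro t e
  refine ⟨t, le_rfl, ?_⟩
  have h0 : (𝟙 N : N ⟶ N) = 0 := by ext x; exact Subsingleton.elim _ _
  have : e = 0 := by
    rw [← Ext.comp_mk₀_id e, h0]; simp
  rw [this, Ext.comp_zero]

lemma smul_Q (I : Ideal R) (t : ℕ) {x : R} (hx : x ∈ I) :
    (x ^ t) • 𝟙 ((Q I).obj (op t)) = 0 := by
  ext (y : R ⧸ I ^ t)
  obtain ⟨y, rfl⟩ := Ideal.Quotient.mk_surjective y
  change Ideal.Quotient.mk (I ^ t) (x ^ t * y) = 0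
  exact Ideal.Quotient.eq_zero_iff_mem.mpr (Ideal.mul_mem_right _ _ (Ideal.pow_mem_pow hx t))

lemma smul_Ext (I : Ideal R) (t j : ℕ) {x : R} (hx : x ∈ I) {N : ModuleCat.{u} R}
    (e : Abelian.Ext ((Q I).obj (op t)) N j) : (x ^ t) • e = 0 := by
  have := congrArg (fun f => (Ext.mk₀ f).comp e (zero_add _)) (smul_Q I t hx)
  simpa [Ext.mk₀_smul, Ext.smul_comp] using this

/-- the nonzerodivisor step -/
lemma V_nzd (I : Ideal R) (j : ℕ) {x : R} (hx : x ∈ I) {S : ShortComplex (ModuleCat.{u} R)}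
    (hS : S.ShortExact) (φ : S.X₁ ≅ S.X₂) (hφ : S.f = x • φ.hom)
    (h3 : V I j S.X₃) : V I (j + 1) S.X₁ := by
  have key : ∀ (k t : ℕ) (e : Abelian.Ext ((Q I).obj (op t)) S.X₁ (j + 1)), x ^ k • e = 0 →
      ∃ (s : ℕ) (h : t ≤ s), (Abelian.Ext.mk₀ (tr I h)).comp e (zero_add _) = 0 := by
    intro k
    induction k with
    | zero => intro t e he; exact ⟨t, le_rfl, by rw [pow_zero, one_smul] at he; rw [he, Ext.comp_zero]⟩
    | succ k ih =>
      intro t e he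
      have h1 : (x ^ k • e).comp (Ext.mk₀ S.f) (add_zero _) = 0 := by
        rw [hφ, Ext.mk₀_smul, Ext.comp_smul, ← Ext.smul_comp, smul_smul, ← pow_succ', he,
          Ext.zero_comp]
      obtain ⟨e3, he3⟩ := Ext.covariant_sequence_exact₁ _ hS _ h1 rfl
      obtain ⟨s, hs, h0⟩ := h3 t e3
      have h2 : x ^ k • ((Abelian.Ext.mk₀ (tr I hs)).comp e (zero_add _)) = 0 := by
        rw [← Ext.comp_smul, ← he3, ← Ext.comp_assoc _ _ _ (zero_add _) rfl (by lia), h0,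
          Ext.zero_comp]
      obtain ⟨r, hr, h4⟩ := ih s _ h2
      exact ⟨r, hs.trans hr, by rw [← tr_tr I hs hr, h4]⟩
  intro t e
  exact key t t e (smul_Ext I t _ hx e)

lemma ext_shift {S S' : ShortComplex (ModuleCat.{u} R)} (hS : S.ShortExact) (hS' : S'.ShortExact)
    (φ : S' ⟶ S) {N : ModuleCat.{u} R} {j j' : ℕ} (e : Abelian.Ext S.X₁ N j) (h : 1 + j = j') :
    (Ext.mk₀ φ.τ₃).comp (hS.extClass.comp e h) (zero_add _) =
      hS'.extClass.comp ((Ext.mk₀ φ.τ₁).comp e (zero_add _)) h := by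
  rw [← Ext.comp_assoc _ _ _ (zero_add _) h (by lia), ← ShortComplex.ShortExact.extClass_naturality hS' hS φ,
    Ext.comp_assoc_of_second_deg_zero]

/-- morphism of kernel complexes -/
def kerHom {F A F' B : Type u} [AddCommGroup F] [AddCommGroup A] [AddCommGroup F'] [AddCommGroup B]
    [Module R F] [Module R A] [Module R F'] [Module R B] (f : F →ₗ[R] A) (f' : F' →ₗ[R] B)
    (g : B →ₗ[R] A) (gF : F' →ₗ[R] F) (h : f ∘ₗ gF = g ∘ₗ f') :
    f'.shortComplexKer ⟶ f.shortComplexKer where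
  τ₁ := ModuleCat.ofHom (gF.restrict (p := LinearMap.ker f') (q := LinearMap.ker f) (by
    intro x hx
    have := LinearMap.congr_fun h x
    simp only [LinearMap.comp_apply, LinearMap.mem_ker] at *
    rw [this, hx, map_zero]))
  τ₂ := ModuleCat.ofHom gF
  τ₃ := ModuleCat.ofHom g
  comm₁₂ := by ext x; rfl
  comm₂₃ := by ext x; exact LinearMap.congr_fun h x

lemma mem_smul_top_sub {F : Type u} [AddCommGroup F] [Module R F] (J : Ideal R)
    (K : Submodule R F) (x : K) (hx : (x : F) ∈ J • K) : x ∈ (J • ⊤ : Submodule R K) := by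
  have : Submodule.map K.subtype (J • ⊤) = J • K := by
    rw [Submodule.map_smul'', Submodule.map_top, Submodule.range_subtype]
  rw [← this] at hx
  obtain ⟨y, hy, hyx⟩ := hx
  have : y = x := Subtype.ext hyx
  rwa [← this]

lemma torsion_zero [IsNoetherianRing R] (I : Ideal R) (m : ℕ) (N : ModuleCat.{u} R)
    (hN : I ^ m ≤ Module.annihilator R N) (j : ℕ) :
    ∀ (A : ModuleCat.{u} R) [Module.Finite R A], ∃ c : ℕ, ∀ (B : ModuleCat.{u} R) (g : B ⟶ A),
      (∀ b, g.hom b ∈ (I ^ c • ⊤ : Submodule R A)) → ∀ e : Abelian.Ext A N j,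
        (Ext.mk₀ g).comp e (zero_add _) = 0 := by
  induction j with
  | zero =>
    intro A _
    refine ⟨m, fun B g hg e => ?_⟩
    obtain ⟨h, rfl⟩ := (Ext.mk₀_bijective A N).2 e
    have : g ≫ h = 0 := by
      ext b
      change h.hom (g.hom b) = 0
      have hb := Submodule.mem_map_of_mem (f := h.hom) (hg b)
      rw [Submodule.map_smul''] at hb
      have hz : (I ^ m • Submodule.map h.hom ⊤ : Submodule R N) ≤ ⊥ := by
        rw [Submodule.smul_le]
        intro r hr n _
        exact Module.mem_annihilator.mp (hN hr) n
      exact hz hb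
    rw [Ext.mk₀_comp_mk₀, this, Ext.mk₀_zero]
  | succ j ih =>
    intro A _
    obtain ⟨n, f, hf⟩ := Module.Finite.exists_fin' R A
    obtain ⟨c, hc⟩ := ih (ModuleCat.of R (LinearMap.ker f))
    obtain ⟨k, hk⟩ := Ideal.exists_pow_inf_eq_pow_smul I (LinearMap.ker f)
    refine ⟨c + k, fun B g hg e => ?_⟩
    have hS := LinearMap.shortExact_shortComplexKer hf
    have : Projective f.shortComplexKer.X₂ :=
      (IsProjective.iff_projective _).mp (inferInstanceAs (Module.Projective R (Fin n → R)))
    obtain ⟨e1, rfl⟩ := precomp_extClass_surjective_of_projective_X₂ N hS j e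
    set π : (B →₀ R) →ₗ[R] B := Finsupp.linearCombination R id with hπ
    have hπs : Function.Surjective π := fun b => ⟨Finsupp.single b 1, by simp [hπ]⟩
    have hS' := LinearMap.shortExact_shortComplexKer hπs
    -- the lift
    have hmap : Submodule.map f (I ^ (c + k) • ⊤) = I ^ (c + k) • ⊤ := by
      rw [Submodule.map_smul'', Submodule.map_top, LinearMap.range_eq_top.mpr hf]
    let fr : (I ^ (c + k) • ⊤ : Submodule R (Fin n → R)) →ₗ[R] (I ^ (c + k) • ⊤ : Submodule R A) :=
      f.restrict (fun x hx => hmap ▸ Submodule.mem_map_of_mem hx)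
    have hfr : Function.Surjective fr := by
      rintro ⟨y, hy⟩
      rw [← hmap] at hy
      obtain ⟨x, hx, hxy⟩ := hy
      exact ⟨⟨x, hx⟩, Subtype.ext hxy⟩
    let gr : (B →₀ R) →ₗ[R] (I ^ (c + k) • ⊤ : Submodule R A) :=
      (g.hom ∘ₗ π).codRestrict _ (fun x => hg _)
    obtain ⟨l, hl⟩ := Module.projective_lifting_property fr gr hfr
    let gF : (B →₀ R) →ₗ[R] (Fin n → R) := (Submodule.subtype _) ∘ₗ l
    have hgF : f ∘ₗ gF = g.hom ∘ₗ π := by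
      exact LinearMap.ext fun x => congrArg Subtype.val (LinearMap.congr_fun hl x)
    have := ext_shift hS hS' (kerHom f π g.hom gF hgF) e1 (add_comm 1 j)
    refine this.trans ?_
    refine (congrArg (fun z => Ext.comp _ z _) (hc _ _ ?_ e1)).trans (Ext.comp_zero _ _ _ _ _)
    rintro ⟨b, hb⟩
    apply mem_smul_top_sub
    have h1 : gF b ∈ (I ^ (c + k) • ⊤ ⊓ LinearMap.ker f : Submodule R (Fin n → R)) := by
      refine ⟨(l b).2, ?_⟩
      change f (gF b) = 0
      have := LinearMap.congr_fun hgF b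
      simp only [LinearMap.comp_apply] at this
      rw [LinearMap.mem_ker] at hb
      erw [this]; rw [hb, map_zero]
    rw [hk _ (by lia), Nat.add_sub_cancel] at h1
    exact Submodule.smul_mono le_rfl inf_le_right h1

lemma V_torsion [IsNoetherianRing R] (I : Ideal R) (m : ℕ) (N : ModuleCat.{u} R)
    (hN : I ^ m ≤ Module.annihilator R N) (j : ℕ) : V I (j + 1) N := by
  intro t e
  obtain ⟨c, hc⟩ := torsion_zero I m N hN j (ModuleCat.of R (LinearMap.ker (Submodule.mkQ (I ^ t))))
  have hS := LinearMap.shortExact_shortComplexKer (Submodule.mkQ_surjective (I ^ t))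
  have hS' := LinearMap.shortExact_shortComplexKer (Submodule.mkQ_surjective (I ^ (t + c)))
  have : Projective (Submodule.mkQ (I ^ t)).shortComplexKer.X₂ :=
      (IsProjective.iff_projective _).mp (inferInstanceAs (Module.Projective R R))
  obtain ⟨e1, rfl⟩ := precomp_extClass_surjective_of_projective_X₂ N hS j e
  refine ⟨t + c, Nat.le_add_right _ _, ?_⟩
  have := ext_shift hS hS' (kerHom (Submodule.mkQ (I ^ t)) (Submodule.mkQ (I ^ (t + c)))
    (tr I (Nat.le_add_right t c)).hom LinearMap.id rfl) e1 (add_comm 1 j)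
  refine this.trans ?_
  refine (congrArg (fun z => Ext.comp _ z _) (hc _ _ ?_ e1)).trans (Ext.comp_zero _ _ _ _ _)
  rintro ⟨b, hb⟩
  apply mem_smul_top_sub
  have hb' : b ∈ I ^ c • LinearMap.ker (Submodule.mkQ (I ^ t)) := by
    rw [Submodule.ker_mkQ] at hb ⊢
    rw [pow_add, mul_comm] at hb
    exact hb
  exact hb'

lemma V_mid' (I : Ideal R) (j : ℕ) {N₁ N₂ N₃ : Type u} [AddCommGroup N₁] [AddCommGroup N₂]
    [AddCommGroup N₃] [Module R N₁] [Module R N₂] [Module R N₃] (f : N₁ →ₗ[R] N₂)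
    (g : N₂ →ₗ[R] N₃) (hf : Function.Injective f) (hg : Function.Surjective g)
    (hfg : Function.Exact f g) (h1 : V I j (ModuleCat.of R N₁)) (h3 : V I j (ModuleCat.of R N₃)) :
    V I j (ModuleCat.of R N₂) :=
  V_mid I j (ModuleCat.shortComplex_shortExact
    (ModuleCat.shortComplexOfCompEqZero f g hfg.linearMap_comp_eq_zero) hfg hf hg) h1 h3

lemma V_right' (I : Ideal R) (j : ℕ) {N₁ N₂ N₃ : Type u} [AddCommGroup N₁] [AddCommGroup N₂]
    [AddCommGroup N₃] [Module R N₁] [Module R N₂] [Module R N₃] (f : N₁ →ₗ[R] N₂)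
    (g : N₂ →ₗ[R] N₃) (hf : Function.Injective f) (hg : Function.Surjective g)
    (hfg : Function.Exact f g) (h1 : V I (j + 1) (ModuleCat.of R N₁))
    (h2 : V I j (ModuleCat.of R N₂)) :
    V I j (ModuleCat.of R N₃) :=
  V_right I j (ModuleCat.shortComplex_shortExact
    (ModuleCat.shortComplexOfCompEqZero f g hfg.linearMap_comp_eq_zero) hfg hf hg) h1 h2

lemma V_nzd' (I : Ideal R) (j : ℕ) {x : R} (hx : x ∈ I) {N₁ N₃ : Type u} [AddCommGroup N₁]
    [AddCommGroup N₃] [Module R N₁] [Module R N₃] 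
    (g : N₁ →ₗ[R] N₃) (hf : Function.Injective (LinearMap.lsmul R N₁ x))
    (hg : Function.Surjective g)
    (hfg : Function.Exact (LinearMap.lsmul R N₁ x) g) 
    (h3 : V I j (ModuleCat.of R N₃)) :
    V I (j + 1) (ModuleCat.of R N₁) :=
  V_nzd I j hx (ModuleCat.shortComplex_shortExact
    (ModuleCat.shortComplexOfCompEqZero _ g hfg.linearMap_comp_eq_zero) hfg hf hg)
    (Iso.refl _) (by ext; rfl) h3

lemma V_list [IsNoetherianRing R] (I : Ideal R) (l : List R) : (∀ x ∈ l, x ∈ I) →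
    ∀ (N : Type u) [AddCommGroup N] [Module R N] [Module.Finite R N],
    I ≤ (Module.annihilator R N ⊔ Ideal.span {x | x ∈ l}).radical →
    ∀ j, l.length < j → V I j (ModuleCat.of R N) := by
  induction l with
  | nil =>
    intro _ N _ _ _ h j hj
    obtain ⟨j, rfl⟩ := Nat.exists_eq_succ_of_ne_zero (Nat.pos_iff_ne_zero.mp hj)
    have h' : I ≤ (Module.annihilator R N).radical := by simpa using h
    obtain ⟨m, hm⟩ := Ideal.exists_pow_le_of_le_radical_of_fg h' (IsNoetherian.noetherian I)
    exact V_torsion I m _ hm j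
  | cons x l ih =>
    intro hl N _ _ _ h j hj
    have hx : x ∈ I := hl x (by simp)
    have hl' : ∀ y ∈ l, y ∈ I := fun y hy => hl y (by simp [hy])
    have h' : I ≤ (Module.annihilator R N ⊔ Ideal.span {x} ⊔ Ideal.span {y | y ∈ l}).radical := by
      refine h.trans (Ideal.radical_mono ?_)
      rw [sup_assoc, ← Ideal.span_union]
      refine sup_le_sup le_rfl (Ideal.span_mono ?_)
      intro y hy
      simpa using hy
    -- a criterion
    have crit : ∀ (N' : Type u) [AddCommGroup N'] [Module R N'] [Module.Finite R N'] (k : ℕ),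
        Module.annihilator R N ≤ Module.annihilator R N' → x ^ k ∈ Module.annihilator R N' →
        ∀ j, l.length < j → V I j (ModuleCat.of R N') := by
      intro N' _ _ _ k h1 h2
      refine ih hl' N' ?_
      refine h'.trans ?_
      rw [Ideal.radical_le_radical_iff]
      refine sup_le (sup_le ?_ ?_) ?_
      · exact (h1.trans le_sup_left).trans Ideal.le_radical
      · rw [Ideal.span_singleton_le_iff_mem]
        exact ⟨k, Ideal.mem_sup_left h2⟩
      · exact le_sup_right.trans Ideal.le_radical
    -- the torsion part
    obtain ⟨k, hk⟩ : ∃ k, ∀ n, k ≤ n → LinearMap.ker (LinearMap.lsmul R N x ^ k) = LinearMap.ker (LinearMap.lsmul R N x ^ n) :=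
      monotone_stabilizes_iff_noetherian.mpr inferInstance
        (LinearMap.iterateKer (LinearMap.lsmul R N x))
    have hpow : ∀ (n : ℕ) (y : N), (LinearMap.lsmul R N x ^ n) y = x ^ n • y := by
      intro n y
      induction n with
      | zero => simp
      | succ n ihn => rw [pow_succ', Module.End.mul_apply, ihn, pow_succ', mul_smul]; rfl
    set T := LinearMap.ker (LinearMap.lsmul R N x ^ k) with hT
    have hT' : ∀ y, y ∈ T ↔ x ^ k • y = 0 := fun y => by rw [hT, LinearMap.mem_ker, hpow]
    have hsub : Module.annihilator R N ≤ Module.annihilator R T :=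
      T.subtype.annihilator_le_of_injective T.injective_subtype
    have hquo : Module.annihilator R N ≤ Module.annihilator R (N ⧸ T) :=
      T.mkQ.annihilator_le_of_surjective T.mkQ_surjective
    refine V_mid' I j T.subtype T.mkQ T.injective_subtype T.mkQ_surjective
      (LinearMap.exact_subtype_mkQ T) ?_ ?_
    · refine crit T k hsub ?_ j (by simp at hj; lia)
      rw [Module.mem_annihilator]
      rintro ⟨y, hy⟩
      exact Subtype.ext ((hT' y).mp hy)
    · obtain ⟨j, rfl⟩ := Nat.exists_eq_succ_of_ne_zero (show j ≠ 0 by lia)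
      set L := LinearMap.range (LinearMap.lsmul R (N ⧸ T) x) with hL
      refine V_nzd' I j hx L.mkQ ?_ L.mkQ_surjective ?_ ?_
      · rw [← LinearMap.ker_eq_bot, LinearMap.ker_eq_bot']
        intro y hy
        obtain ⟨y, rfl⟩ := T.mkQ_surjective y
        have hy' : x • y ∈ T := by
          rw [← Submodule.Quotient.mk_eq_zero]; exact hy
        rw [hT', smul_smul, ← pow_succ, ← hpow, ← LinearMap.mem_ker, ← hk (k + 1) (by lia)] at hy'
        exact (Submodule.Quotient.mk_eq_zero _).mpr hy'
      · intro y
        rw [← LinearMap.mem_ker, Submodule.ker_mkQ]; rfl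
      · refine crit ((N ⧸ T) ⧸ L) 1 (hquo.trans (L.mkQ.annihilator_le_of_surjective L.mkQ_surjective))
          ?_ j (by simp at hj; lia)
        rw [Module.mem_annihilator]
        intro y
        obtain ⟨y, rfl⟩ := L.mkQ_surjective y
        rw [pow_one, ← map_smul]
        exact (Submodule.Quotient.mk_eq_zero _).mpr ⟨y, rfl⟩

lemma V_big [IsNoetherianRing R] (I : Ideal R) : ∃ r : ℕ, ∀ j, r < j →
    ∀ (N : Type u) [AddCommGroup N] [Module R N] [Module.Finite R N],
    V I j (ModuleCat.of R N) := by
  obtain ⟨s, hs⟩ := IsNoetherian.noetherian I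
  refine ⟨s.toList.length, fun j hj N _ _ _ => V_list I s.toList ?_ N ?_ j hj⟩
  · intro x hx
    rw [← hs]
    exact Ideal.subset_span (by simpa using hx)
  · refine le_trans ?_ Ideal.le_radical
    refine le_trans ?_ le_sup_right
    rw [← hs]
    exact Ideal.span_mono (fun x hx => by simpa using hx)

lemma V_all [IsNoetherianRing R] (I : Ideal R) (n : ℕ)
    (hn : ∀ j, n < j → V I j (ModuleCat.of R R)) : ∀ j, n < j →
    ∀ (N : Type u) [AddCommGroup N] [Module R N] [Module.Finite R N],
    V I j (ModuleCat.of R N) := by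
  obtain ⟨r, hr⟩ := V_big I
  have key : ∀ d j, n < j → r < j + d → 
      ∀ (N : Type u) [AddCommGroup N] [Module R N] [Module.Finite R N],
      V I j (ModuleCat.of R N) := by
    intro d
    induction d with
    | zero => intro j _ h; exact hr j h
    | succ d ih =>
      intro j hj h N _ _ hfin
      have ih' := ih (j + 1) (by lia) (by lia)
      induction hfin using IsNoetherianRing.induction_on_isQuotientEquivQuotientPrime R with
      | subsingleton N => exact V_of_subsingleton I j _
      | quotient N p f =>
        refine V_right' I j (Submodule.subtype p.1) (f.symm.toLinearMap ∘ₗ Submodule.mkQ p.1)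
          (Submodule.injective_subtype _) (f.symm.surjective.comp (Submodule.mkQ_surjective _))
          ?_ (ih' _) (hn j hj)
        intro y
        simp [LinearMap.comp_apply]
        exact Ideal.Quotient.eq_zero_iff_mem
      | exact N₁ N₂ N₃ f g hf hg hfg h₁ h₃ => exact V_mid' I j f g hf hg hfg h₁ h₃
  intro j hj
  exact key (r + 1) j hj (by lia)

section bridge

open Limits

variable {D : Type*} [Category* D] [Abelian D]

/-- the class of a cocycle -/
def cls (K : ChainComplex D ℕ) (i : ℕ) {J : D} (f : K.X i ⟶ J) (hf : K.d (i + 1) i ≫ f = 0) :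
    K.homology i ⟶ J :=
  K.homologyι i ≫ K.descOpcycles f (i + 1) (by simp) hf

lemma cls_aux {K L : ChainComplex D ℕ} (φ : L ⟶ K) (i : ℕ) {J : D} (f : K.X i ⟶ J)
    (hf : K.d (i + 1) i ≫ f = 0) : L.d (i + 1) i ≫ φ.f i ≫ f = 0 := by
  rw [← φ.comm_assoc, hf, Limits.comp_zero]

lemma cls_nat {K L : ChainComplex D ℕ} (φ : L ⟶ K) (i : ℕ) {J : D} (f : K.X i ⟶ J)
    (hf : K.d (i + 1) i ≫ f = 0) (hf' : L.d (i + 1) i ≫ φ.f i ≫ f = 0) :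
    HomologicalComplex.homologyMap φ i ≫ cls K i f hf = cls L i (φ.f i ≫ f) hf' := by
  unfold cls
  rw [HomologicalComplex.homologyι_naturality_assoc]
  congr 1
  rw [← cancel_epi (L.pOpcycles i)]
  simp

lemma cls_zero (K : ChainComplex D ℕ) (i : ℕ) {J : D} [Injective J] (f : K.X (i + 1) ⟶ J)
    (hf : K.d (i + 1 + 1) (i + 1) ≫ f = 0) (h0 : cls K (i + 1) f hf = 0) :
    ∃ g : K.X i ⟶ J, K.d (i + 1) i ≫ g = f := by
  have hex : (ShortComplex.mk _ _ (K.homologyι_comp_fromOpcycles (i + 1) i)).Exact :=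
    ShortComplex.exact_of_f_is_kernel _ (K.homologyIsKernel (i + 1) i (by simp))
  refine ⟨hex.descToInjective (K.descOpcycles f (i + 1 + 1) (by simp) hf) h0, ?_⟩
  have := hex.comp_descToInjective (K.descOpcycles f (i + 1 + 1) (by simp) hf) h0
  rw [← K.p_fromOpcycles, Category.assoc]
  dsimp at this
  rw [this]
  simp

lemma cancel_aux {W X Y Z J : D} {a : W ⟶ X} {b : X ⟶ Y} {c : W ⟶ Z} {d : Z ⟶ Y} {k : Y ⟶ J}
    [IsIso c] (h : a ≫ b = c ≫ d) (h0 : a ≫ b ≫ k = 0) : d ≫ k = 0 := by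
  rw [reassoc_of% h, Preadditive.IsIso.comp_left_eq_zero] at h0
  exact h0

end bridge

/-- hom functor -/
abbrev Hm (N : ModuleCat.{u} R) : ModuleCat.{u} R ⥤ (ModuleCat.{u} R)ᵒᵖ :=
  ((linearYoneda R (ModuleCat.{u} R)).obj N).rightOp

/-- the opposite of a point of Hom -/
def pt {X N : ModuleCat.{u} R} (f : X ⟶ N) : (Hm N).obj X ⟶ op (ModuleCat.of R R) :=
  Quiver.Hom.op (ModuleCat.ofHom (LinearMap.toSpanSingleton R (X ⟶ N) f) :
    ModuleCat.of R R ⟶ ModuleCat.of R (X ⟶ N))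

lemma pt_nat {X Y N : ModuleCat.{u} R} (g : Y ⟶ X) (f : X ⟶ N) :
    (Hm N).map g ≫ pt f = pt (g ≫ f) := by
  apply Quiver.Hom.unop_inj
  refine ModuleCat.hom_ext (LinearMap.ext_ring ?_)
  change g ≫ ((1 : R) • f) = (1 : R) • (g ≫ f)
  simp

lemma pt_zero {X N : ModuleCat.{u} R} : pt (0 : X ⟶ N) = 0 := by
  apply Quiver.Hom.unop_inj
  refine ModuleCat.hom_ext (LinearMap.ext_ring ?_)
  change (1 : R) • (0 : X ⟶ N) = 0
  simp

lemma pt_surj {X N : ModuleCat.{u} R} (g : (Hm N).obj X ⟶ op (ModuleCat.of R R)) :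
    ∃ f : X ⟶ N, pt f = g := by
  refine ⟨g.unop.hom (1 : R), ?_⟩
  apply Quiver.Hom.unop_inj
  refine ModuleCat.hom_ext (LinearMap.ext_ring ?_)
  change (1 : R) • (g.unop.hom (1 : R) : X ⟶ N) = g.unop.hom (1 : R)
  exact one_smul _ _

lemma pt_inj {X N : ModuleCat.{u} R} {f g : X ⟶ N} (h : pt f = pt g) : f = g := by
  have := congrArg (fun k => k.unop.hom (1 : R)) h
  change (1 : R) • f = (1 : R) • g at this
  simpa using this

/-- the key statement about a colimit -/
lemma LC_zero (I : Ideal R) (i : ℕ) (N : ModuleCat.{u} R) [hs : Subsingleton (LC R I i N)] (t : ℕ)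
    (x : ((_root_.Ext R (ModuleCat.{u} R) i).obj (op ((Q I).obj (op t)))).obj N) :
    ∃ (s : ℕ) (h : t ≤ s),
      (((_root_.Ext R (ModuleCat.{u} R) i).map (tr I h).op).app N).hom x = 0 := by
  let G := localCohomology.diagram (localCohomology.idealPowersDiagram I) i
  have hc : Limits.IsColimit (((evaluation _ _).obj N).mapCocone (Limits.colimit.cocone G)) :=
    Limits.isColimitOfPreserves _ (Limits.colimit.isColimit G)
  have : Limits.PreservesFilteredColimitsOfSize.{0, 0} (forget (ModuleCat.{u} R)) :=
    Limits.preservesFilteredColimitsOfSize_shrink.{0, u, 0, u} _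
  have := (hc.eq_iff' (i := op (op t)) x 0).mp
    (@Subsingleton.elim _ hs _ _)
  obtain ⟨j, f, hf⟩ := this
  refine ⟨j.unop.unop, f.unop.unop.le, ?_⟩
  rw [map_zero] at hf
  exact hf

lemma bridge (I : Ideal R) (i : ℕ) (N : ModuleCat.{u} R)
    [hs : Subsingleton (LC R I (i + 1) N)] : V I (i + 1) N := by
  intro t e
  let P : ∀ s : ℕ, ProjectiveResolution ((Q I).obj (op s)) := fun s => projectiveResolution _
  obtain ⟨f, hf, rfl⟩ := (P t).extMk_surjective e _ rfl
  let K : ℕ → ChainComplex (ModuleCat.{u} R)ᵒᵖ ℕ := fun s =>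
    ((Hm N).mapHomologicalComplex _).obj (P s).complex
  have hf' : (K t).d (i + 1 + 1) (i + 1) ≫ pt f = 0 := by
    refine (pt_nat _ _).trans ?_
    rw [hf, pt_zero]; rfl
  let c : (K t).homology (i + 1) ⟶ op (ModuleCat.of R R) := cls (K t) (i + 1) (pt f) hf'
  let iso := fun s => (P s).isoLeftDerivedObj (Hm N) (i + 1)
  let x := ((iso t).hom ≫ c).unop
  obtain ⟨s, h, hx⟩ := LC_zero I (i + 1) N t (x.hom (1 : R))
  refine ⟨s, h, ?_⟩
  let φ : ProjectiveResolution.Hom (P s) (P t) (tr I h) :=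
    ⟨ProjectiveResolution.lift (tr I h) (P s) (P t), (ProjectiveResolution.lift_commutes_zero _ _ _).trans (by simp)⟩
  rw [ProjectiveResolution.mk₀_comp_extMk _ _ _ _ φ,
    ProjectiveResolution.extMk_eq_zero_iff _ _ _ _ _ i rfl]
  have h1 : ((Hm N).leftDerived (i + 1)).map (tr I h) ≫ (iso t).hom ≫ c = 0 := by
    apply Quiver.Hom.unop_inj
    exact ModuleCat.hom_ext (LinearMap.ext_ring hx)
  have h2 := (P s).isoLeftDerivedObj_hom_naturality (tr I h) (P t) φ.hom
    (ProjectiveResolution.lift_commutes_zero _ _ _)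
    (Hm N) (i + 1)
  replace h1 := cancel_aux h2 h1
  let ψ : K s ⟶ K t := ((Hm N).mapHomologicalComplex _).map φ.hom
  have e1 : ψ.f (i + 1) ≫ pt f = pt (φ.hom.f (i + 1) ≫ f) := pt_nat _ _
  have e2 : (K s).d (i + 1 + 1) (i + 1) ≫ ψ.f (i + 1) ≫ pt f = 0 :=
    cls_aux ψ (i + 1) (pt f) hf'
  have h3 := cls_nat ψ (i + 1) (pt f) hf' e2
  have h4 : cls (K s) (i + 1) (ψ.f (i + 1) ≫ pt f) e2 = 0 := by
    rw [← h3]; exact h1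
  have : Projective (ModuleCat.of R R) := inferInstance
  obtain ⟨g, hg⟩ := cls_zero _ _ _ _ h4
  obtain ⟨g, rfl⟩ := pt_surj g
  refine ⟨g, pt_inj ?_⟩
  rw [← e1, ← hg, ← pt_nat]
  rfl

open MonoidalCategory in
/-- tensoring with a complex -/
def G (C : ChainComplex (ModuleCat.{u} R) ℕ) :
    ModuleCat.{u} R ⥤ ChainComplex (ModuleCat.{u} R) ℕ where
  obj A := (((tensoringLeft (ModuleCat.{u} R)).obj A).mapHomologicalComplex _).obj C
  map g := (NatTrans.mapHomologicalComplex ((tensoringLeft (ModuleCat.{u} R)).map g) _).app C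
  map_id A := by
    ext i : 1
    exact congrArg (fun f => NatTrans.app f (C.X i)) ((tensoringLeft (ModuleCat.{u} R)).map_id A)
  map_comp f g := by
    ext i : 1
    exact congrArg (fun f => NatTrans.app f (C.X i))
      ((tensoringLeft (ModuleCat.{u} R)).map_comp f g)

instance (C : ChainComplex (ModuleCat.{u} R) ℕ) : (G C).PreservesZeroMorphisms where
  map_zero A B := by
    ext i : 1
    exact MonoidalPreadditive.zero_whiskerRight

/-- the structure of a homological functor -/
structure HF (T : ℕ → ModuleCat.{u} R ⥤ ModuleCat.{u} R) where
  δ : ∀ {S : ShortComplex (ModuleCat.{u} R)} (_ : S.ShortExact) (i : ℕ),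
    (T (i + 1)).obj S.X₃ ⟶ (T i).obj S.X₁
  zero : ∀ (F : ModuleCat.{u} R) [Projective F] (i : ℕ), Subsingleton ((T (i + 1)).obj F)
  ex₂ : ∀ {S : ShortComplex (ModuleCat.{u} R)} (_ : S.ShortExact) (i : ℕ),
    Function.Exact ((T i).map S.f).hom ((T i).map S.g).hom
  ex₃ : ∀ {S : ShortComplex (ModuleCat.{u} R)} (hS : S.ShortExact) (i : ℕ),
    Function.Exact ((T (i + 1)).map S.g).hom (δ hS i).hom
  ex₁ : ∀ {S : ShortComplex (ModuleCat.{u} R)} (hS : S.ShortExact) (i : ℕ),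
    Function.Exact (δ hS i).hom ((T i).map S.f).hom
  nat : ∀ {S S' : ShortComplex (ModuleCat.{u} R)} (hS : S.ShortExact) (hS' : S'.ShortExact)
    (φ : S' ⟶ S) (i : ℕ), δ hS' i ≫ (T i).map φ.τ₁ = (T (i + 1)).map φ.τ₃ ≫ δ hS i
  sur : ∀ {S : ShortComplex (ModuleCat.{u} R)} (_ : S.ShortExact),
    Function.Surjective ((T 0).map S.g).hom

lemma G_short {C : ChainComplex (ModuleCat.{u} R) ℕ} [∀ i, Projective (C.X i)]
    {S : ShortComplex (ModuleCat.{u} R)} (hS : S.ShortExact) : (S.map (G C)).ShortExact := by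
  refine HomologicalComplex.shortExact_of_degreewise_shortExact _ fun i => ?_
  have hfl : Module.Flat R (C.X i) := by
    have : Module.Projective R (C.X i) := (IsProjective.iff_projective _).mpr inferInstance
    infer_instance
  have h1 := Module.Flat.rTensor_shortComplex_exact (C.X i) S hS.exact
  have := hS.mono_f
  have := hS.epi_g
  refine @ShortComplex.ShortExact.mk _ _ _ _ h1 ?_ ?_
  · exact (inferInstance : Mono ((MonoidalCategory.tensorRight (C.X i)).map S.f))
  · exact (inferInstance : Epi ((MonoidalCategory.tensorRight (C.X i)).map S.g))

lemma epi_h0 {K L : ChainComplex (ModuleCat.{u} R) ℕ} (f : K ⟶ L) [Epi f] :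
    Epi (HomologicalComplex.homologyMap f 0) := by
  have : IsIso (K.homologyι 0) := K.isIso_homologyι 0 _ rfl (by simp)
  have : IsIso (L.homologyι 0) := L.isIso_homologyι 0 _ rfl (by simp)
  have h := HomologicalComplex.homologyι_naturality f 0
  have h1 : Epi (HomologicalComplex.opcyclesMap f 0) := inferInstance
  have h2 : Epi (HomologicalComplex.homologyMap f 0 ≫ L.homologyι 0) := by
    rw [h]; infer_instance
  have h3 : HomologicalComplex.homologyMap f 0 =
      (HomologicalComplex.homologyMap f 0 ≫ L.homologyι 0) ≫ inv (L.homologyι 0) := by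
    rw [Category.assoc, IsIso.hom_inv_id, Category.comp_id]
  rw [h3]
  infer_instance

/-- the Tor functors -/
abbrev T (C : ChainComplex (ModuleCat.{u} R) ℕ) (i : ℕ) : ModuleCat.{u} R ⥤ ModuleCat.{u} R :=
  G C ⋙ HomologicalComplex.homologyFunctor _ _ i

/-- it is homological -/
def hfT {M : ModuleCat.{u} R} (P : ProjectiveResolution M) : HF (T P.complex) where
  δ hS i := (G_short (C := P.complex) hS).δ (i + 1) i (by simp)
  zero F _ i := by
    have : Module.Flat R F := by
      have : Module.Projective R F := (IsProjective.iff_projective _).mpr inferInstance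
      infer_instance
    have h := P.complex_exactAt_succ i
    rw [HomologicalComplex.exactAt_iff] at h
    have h2 := Module.Flat.lTensor_shortComplex_exact F _ h
    have h3 : ((G P.complex).obj F).ExactAt (i + 1) := h2
    exact ModuleCat.subsingleton_of_isZero h3.isZero_homology
  ex₂ hS i := (ShortComplex.ShortExact.moduleCat_exact_iff_function_exact _).mp
    ((G_short (C := P.complex) hS).homology_exact₂ i)
  ex₃ hS i := (ShortComplex.ShortExact.moduleCat_exact_iff_function_exact _).mp
    ((G_short (C := P.complex) hS).homology_exact₃ (i + 1) i (by simp))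
  ex₁ hS i := (ShortComplex.ShortExact.moduleCat_exact_iff_function_exact _).mp
    ((G_short (C := P.complex) hS).homology_exact₁ (i + 1) i (by simp))
  nat hS hS' φ i := HomologicalComplex.HomologySequence.δ_naturality
    ((G P.complex).mapShortComplex.map φ) (G_short hS') (G_short hS) (i + 1) i (by simp)
  sur {S} hS := by
    have h := G_short (C := P.complex) hS
    have h' : Epi (S.map (G P.complex)).g := h.epi_g
    rw [← ModuleCat.epi_iff_surjective]
    exact epi_h0 (S.map (G P.complex)).g

lemma torIso {M : ModuleCat.{u} R} (P : ProjectiveResolution M) (i : ℕ) (A : ModuleCat.{u} R) :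
    Nonempty (TorMod R i A M ≅ (T P.complex i).obj A) :=
  ⟨P.isoLeftDerivedObj _ i⟩

lemma detect [IsNoetherianRing R] {T : ℕ → ModuleCat.{u} R ⥤ ModuleCat.{u} R} (H : HF T)
    (j : ℕ) : ∀ (A : ModuleCat.{u} R) [Module.Finite R A],
    ∃ (N : ModuleCat.{u} R) (_ : Module.Finite R N) (η : Abelian.Ext A N (j + 1)),
      ∀ (B : ModuleCat.{u} R) (g : B ⟶ A), (Ext.mk₀ g).comp η (zero_add _) = 0 →
        ∀ x, ((T (j + 1)).map g).hom x = 0 := by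
  induction j with
  | zero =>
    intro A _
    obtain ⟨n, f, hf⟩ := Module.Finite.exists_fin' R A
    have hS := LinearMap.shortExact_shortComplexKer hf
    have : Projective f.shortComplexKer.X₂ :=
      (IsProjective.iff_projective _).mp (inferInstanceAs (Module.Projective R (Fin n → R)))
    refine ⟨ModuleCat.of R (LinearMap.ker f), inferInstanceAs (Module.Finite R (LinearMap.ker f)),
      hS.extClass, fun B g hg x => ?_⟩
    obtain ⟨l, hl⟩ := Ext.covariant_sequence_exact₃ _ hS _ rfl hg
    obtain ⟨l, rfl⟩ := (Ext.mk₀_bijective _ _).2 l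
    rw [Ext.mk₀_comp_mk₀] at hl
    have hl' : l ≫ f.shortComplexKer.g = g := (Ext.mk₀_bijective _ _).1 hl
    rw [← hl']
    have := H.zero f.shortComplexKer.X₂ 0
    rw [Functor.map_comp, ModuleCat.hom_comp, LinearMap.comp_apply,
      Subsingleton.elim (((T (0 + 1)).map l).hom x) 0, map_zero]
  | succ j ih =>
    intro A _
    obtain ⟨n, f, hf⟩ := Module.Finite.exists_fin' R A
    have hS := LinearMap.shortExact_shortComplexKer hf
    have : Projective f.shortComplexKer.X₂ :=
      (IsProjective.iff_projective _).mp (inferInstanceAs (Module.Projective R (Fin n → R)))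
    obtain ⟨N, hN, η, hη⟩ := ih (ModuleCat.of R (LinearMap.ker f))
    refine ⟨N, hN, hS.extClass.comp η (add_comm 1 (j + 1)), fun B g hg x => ?_⟩
    set π : (B →₀ R) →ₗ[R] B := Finsupp.linearCombination R id with hπ
    have hπs : Function.Surjective π := fun b => ⟨Finsupp.single b 1, by simp [hπ]⟩
    have hS' := LinearMap.shortExact_shortComplexKer hπs
    have : Projective π.shortComplexKer.X₂ :=
      (IsProjective.iff_projective _).mp (inferInstanceAs (Module.Projective R (B →₀ R)))
    obtain ⟨gF, hgF⟩ := Module.projective_lifting_property f (g.hom ∘ₗ π) hf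
    have h1 := (ext_shift hS hS' (kerHom f π g.hom gF hgF) η (add_comm 1 (j + 1))).symm.trans hg
    obtain ⟨y, hy⟩ := Ext.contravariant_sequence_exact₁ hS' _ _ _ h1
    rw [Ext.eq_zero_of_projective y, Ext.comp_zero] at hy
    have h2 := hη _ _ hy.symm
    have h3 := H.nat hS hS' (kerHom f π g.hom gF hgF) (j + 1)
    have := H.zero f.shortComplexKer.X₂ (j + 1)
    have h4 := H.ex₃ hS (j + 1) (((T (j + 1 + 1)).map g).hom x)
    have h5 : (H.δ hS (j + 1)).hom (((T (j + 1 + 1)).map g).hom x) = 0 := by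
      have := congrArg (fun k => k.hom x) h3
      exact this.symm.trans (h2 _)
    obtain ⟨z, hz⟩ := h4.mp h5
    rw [← hz, Subsingleton.elim z 0, map_zero]

section fin

variable [IsNoetherianRing R]

lemma fin_mid {A B C : Type u} [AddCommGroup A] [AddCommGroup B] [AddCommGroup C] [Module R A]
    [Module R B] [Module R C] (f : A →ₗ[R] B) (g : B →ₗ[R] C) (h : Function.Exact f g)
    [Module.Finite R A] [Module.Finite R C] : Module.Finite R B := by
  have h1 : IsNoetherian R A := inferInstance
  have h2 : IsNoetherian R C := inferInstance
  have := isNoetherian_of_range_eq_ker f g h.linearMap_ker_eq.symm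
  infer_instance

end fin

lemma fin_sub {T : ℕ → ModuleCat.{u} R ⥤ ModuleCat.{u} R} (H : HF T) (i : ℕ) (N : Type u)
    [AddCommGroup N] [Module R N] [Subsingleton N] :
    Module.Finite R ((T i).obj (ModuleCat.of R N)) := by
  have hfg : Function.Exact (LinearMap.id : N →ₗ[R] N) (LinearMap.id : N →ₗ[R] N) :=
    fun y => ⟨fun _ => ⟨y, rfl⟩, fun _ => Subsingleton.elim _ _⟩
  have h := H.ex₂ (ModuleCat.shortComplex_shortExact
    (ModuleCat.shortComplexOfCompEqZero _ _ hfg.linearMap_comp_eq_zero) hfg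
      Function.injective_id Function.surjective_id) i
  have e : ∀ y : (T i).obj (ModuleCat.of R N), y = 0 := by
    intro y
    have hid : (T i).map (ModuleCat.ofHom (LinearMap.id : N →ₗ[R] N)) = 𝟙 _ :=
      (T i).map_id _
    have h1 := (h y).mpr ⟨y, by
      change ((T i).map (ModuleCat.ofHom (LinearMap.id : N →ₗ[R] N))).hom y = y
      rw [hid]; rfl⟩
    change ((T i).map (ModuleCat.ofHom (LinearMap.id : N →ₗ[R] N))).hom y = 0 at h1
    rw [hid] at h1
    exact h1
  have : Subsingleton ((T i).obj (ModuleCat.of R N)) := ⟨fun a b => (e a).trans (e b).symm⟩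
  infer_instance

lemma quot_map (I : Ideal R) {N : Type u} [AddCommGroup N] [Module R N] {p : PrimeSpectrum R}
    (f : N ≃ₗ[R] R ⧸ p.1) (hI : I ≤ (Module.annihilator R N).radical) :
    ∃ q : (R ⧸ I) →ₗ[R] N, Function.Surjective q ∧
      I ≤ (Module.annihilator R (LinearMap.ker q)).radical := by
  have hp : I ≤ p.1 := by
    intro x hx
    obtain ⟨k, hk⟩ := hI hx
    rw [Module.mem_annihilator] at hk
    have h1 := congrArg f (hk (f.symm (Submodule.Quotient.mk 1)))
    rw [map_smul, f.apply_symm_apply, map_zero, ← Submodule.Quotient.mk_smul,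
      Submodule.Quotient.mk_eq_zero] at h1
    refine p.2.mem_of_pow_mem k ?_
    simpa using h1
  refine ⟨f.symm.toLinearMap ∘ₗ Submodule.factor hp, ?_, ?_⟩
  · exact f.symm.surjective.comp (Submodule.factor_surjective hp)
  · refine le_trans ?_ Ideal.le_radical
    intro x hx
    rw [Module.mem_annihilator]
    rintro ⟨y, hy⟩
    apply Subtype.ext
    obtain ⟨y, rfl⟩ := Submodule.mkQ_surjective I y
    refine (Submodule.Quotient.mk_eq_zero I).mpr ?_
    exact Ideal.mul_mem_right _ _ hx

lemma fin_all [IsNoetherianRing R] {T : ℕ → ModuleCat.{u} R ⥤ ModuleCat.{u} R} (H : HF T)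
    (I : Ideal R) (i : ℕ) : (∀ k ≤ i, Module.Finite R ((T k).obj (ModuleCat.of R (R ⧸ I)))) →
    ∀ (A : Type u) [AddCommGroup A] [Module R A] [Module.Finite R A],
      I ≤ (Module.annihilator R A).radical → Module.Finite R ((T i).obj (ModuleCat.of R A)) := by
  induction i with
  | zero =>
    intro h A _ _ hfin
    induction hfin using IsNoetherianRing.induction_on_isQuotientEquivQuotientPrime R with
    | subsingleton N => 
      intro _
      exact fin_sub H 0 N
    | quotient N p f =>
      intro hI
      obtain ⟨q, hq, -⟩ := quot_map I f hI
      have := h 0 le_rfl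
      exact Module.Finite.of_surjective _ (H.sur (LinearMap.shortExact_shortComplexKer hq))
    | exact N₁ N₂ N₃ f g hf hg hfg h₁ h₃ =>
      intro hI
      have := h₁ (hI.trans (Ideal.radical_mono (f.annihilator_le_of_injective hf)))
      have := h₃ (hI.trans (Ideal.radical_mono (g.annihilator_le_of_surjective hg)))
      exact fin_mid _ _ (H.ex₂ (ModuleCat.shortComplex_shortExact
        (ModuleCat.shortComplexOfCompEqZero f g hfg.linearMap_comp_eq_zero) hfg hf hg) 0)
  | succ i ih =>
    intro h A _ _ hfin
    induction hfin using IsNoetherianRing.induction_on_isQuotientEquivQuotientPrime R with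
    | subsingleton N => 
      intro _
      exact fin_sub H (i + 1) N
    | quotient N p f =>
      intro hI
      obtain ⟨q, hq, hk⟩ := quot_map I f hI
      have := h (i + 1) le_rfl
      have := ih (fun k hk => h k (by lia)) (LinearMap.ker q) hk
      exact fin_mid _ _ (H.ex₃ (LinearMap.shortExact_shortComplexKer hq) i)
    | exact N₁ N₂ N₃ f g hf hg hfg h₁ h₃ =>
      intro hI
      have := h₁ (hI.trans (Ideal.radical_mono (f.annihilator_le_of_injective hf)))
      have := h₃ (hI.trans (Ideal.radical_mono (g.annihilator_le_of_surjective hg)))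
      exact fin_mid _ _ (H.ex₂ (ModuleCat.shortComplex_shortExact
        (ModuleCat.shortComplexOfCompEqZero f g hfg.linearMap_comp_eq_zero) hfg hf hg) (i + 1))

lemma main [IsNoetherianRing R] {T : ℕ → ModuleCat.{u} R ⥤ ModuleCat.{u} R} (H : HF T)
    (I : Ideal R) (n : ℕ) (hV : ∀ j, n < j → V I j (ModuleCat.of R R))
    (h : ∀ k ≤ n, Module.Finite R ((T k).obj (ModuleCat.of R (R ⧸ I)))) :
    ∀ k, Module.Finite R ((T k).obj (ModuleCat.of R (R ⧸ I))) := by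
  intro k
  induction k using Nat.strong_induction_on with
  | _ k ih =>
  rcases Nat.lt_or_ge n k with hk | hk
  swap
  · exact h k hk
  obtain ⟨j, rfl⟩ := Nat.exists_eq_succ_of_ne_zero (show k ≠ 0 by lia)
  have hA : Module.Finite R ((Q I).obj (op 1)) := inferInstanceAs (Module.Finite R (R ⧸ I ^ 1))
  obtain ⟨N, hN, η, hη⟩ := detect H j ((Q I).obj (op 1))
  obtain ⟨s, hs, h0⟩ := V_all I n hV (j + 1) hk N 1 η
  have hsur : Function.Surjective (tr I hs).hom := by
    intro y
    obtain ⟨y, rfl⟩ := Submodule.mkQ_surjective _ y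
    exact ⟨Submodule.Quotient.mk y, rfl⟩
  have hS := LinearMap.shortExact_shortComplexKer hsur
  have hB : Module.Finite R ((Q I).obj (op s)) := inferInstanceAs (Module.Finite R (R ⧸ I ^ s))
  have hK : Module.Finite R ((T j).obj (ModuleCat.of R (LinearMap.ker (tr I hs).hom))) := by
    refine fin_all H I j (fun k hk => ih k (by lia)) _ ?_
    intro x hx
    refine ⟨s, ?_⟩
    rw [Module.mem_annihilator]
    rintro ⟨y, hy⟩
    apply Subtype.ext
    obtain ⟨y, rfl⟩ := Submodule.mkQ_surjective (I ^ s) y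
    refine (Submodule.Quotient.mk_eq_zero (I ^ s)).mpr ?_
    exact Ideal.mul_mem_right _ _ (Ideal.pow_mem_pow hx s)
  have hinj : Function.Injective (H.δ hS j).hom := by
    rw [← LinearMap.ker_eq_bot, LinearMap.ker_eq_bot']
    intro m hm
    obtain ⟨z, rfl⟩ := (H.ex₃ hS j m).mp hm
    exact hη _ _ h0 z
  have hfin : Module.Finite R ((T (j + 1)).obj ((Q I).obj (op 1))) :=
    Module.Finite.of_injective (M := (T (j + 1)).obj ((Q I).obj (op 1)))
      (N := (T j).obj (ModuleCat.of R (LinearMap.ker (tr I hs).hom))) (H.δ hS j).hom hinj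
  let e : (Q I).obj (op 1) ≅ ModuleCat.of R (R ⧸ I) :=
    (Submodule.quotEquivOfEq (I ^ 1) I (pow_one I)).toModuleIso
  exact Module.Finite.equiv ((T (j + 1)).mapIso e).toLinearEquiv

end Stmt3Aux

theorem stmt3 (R : Type u) [CommRing R] [IsNoetherianRing R] [IsLocalRing R] (I : Ideal R)
    (M : Type u) [AddCommGroup M] [Module R M] (n : ℕ)
    (hcd₁ : ∀ i : ℕ, n < i → Subsingleton (LC R I i (ModuleCat.of R R)))
    (hcd₂ : ∀ m : ℕ, (∀ i : ℕ, m < i → Subsingleton (LC R I i (ModuleCat.of R R))) → n ≤ m)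
    (h : ∀ i : ℕ, i ≤ n →
      Module.Finite R (TorMod R i (ModuleCat.of R (R ⧸ I)) (ModuleCat.of R M))) :
    ∀ i : ℕ, Module.Finite R (TorMod R i (ModuleCat.of R (R ⧸ I)) (ModuleCat.of R M)) := by
  intro i
  let P := projectiveResolution (ModuleCat.of R M)
  have key := Stmt3Aux.main (Stmt3Aux.hfT P) I n (fun j hj => by
    obtain ⟨j, rfl⟩ := Nat.exists_eq_succ_of_ne_zero (show j ≠ 0 by lia)
    have := hcd₁ _ hj
    exact Stmt3Aux.bridge I j _) (fun k hk => by
    obtain ⟨e⟩ := Stmt3Aux.torIso P k (ModuleCat.of R (R ⧸ I))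
    have := h k hk
    exact Module.Finite.equiv e.toLinearEquiv) i
  obtain ⟨e⟩ := Stmt3Aux.torIso P i (ModuleCat.of R (R ⧸ I))
  exact Module.Finite.equiv e.symm.toLinearEquiv
end
end
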